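/- arXiv:1712.04674 — 3 statements merged into one kernel-verified Lean document; each statement's English description precedes it below -/
import Mathlib

section
/- The set of positive integers n with Möbius function value μ(n) = 1 (i.e., squarefree n with an even number of prime factors) has natural density 3/π²; that is, (1/n)·#{i : 1 ≤ i ≤ n, μ(i) = 1} tends to 3/π² as n → ∞. -/
open Filter Real

section Tauberian

open MeasureTheory Set Topology
open scoped FourierTransform ContDiff

/-- Convolution with `𝓕⁻ k` is the Fourier multiplier with symbol `k`. -/
lemma integral_mul_fourierInv_sub {f k : ℝ → ℂ} (hf : Integrable f) (hk : Integrable k) (x : ℝ) :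
    ∫ t, f t * 𝓕⁻ k (x - t) = 𝓕⁻ (fun u ↦ 𝓕 f u * k u) x := by
  have hkx : Integrable (fun u ↦ (𝐞 (u * x) : ℂ) * k u) := by
    refine hk.bdd_mul (c := 1) (by fun_prop) (ae_of_all _ fun u ↦ ?_)
    simp only [Circle.norm_coe, le_refl]
  have h := VectorFourier.integral_fourierIntegral_smul_eq_flip (μ := volume) (ν := volume)
    (L := innerₗ ℝ) Real.continuous_fourierChar continuous_inner hf hkx
  have h1 : ∀ t, VectorFourier.fourierIntegral 𝐞 volume (innerₗ ℝ).flip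
      (fun u ↦ (𝐞 (u * x) : ℂ) * k u) t = 𝓕⁻ k (x - t) := by
    intro t
    rw [Real.fourierInv_eq]
    refine integral_congr_ae (ae_of_all _ fun u ↦ ?_)
    simp only [LinearMap.flip_apply, innerₗ_apply_apply, RCLike.inner_apply, conj_trivial,
      Circle.smul_def, smul_eq_mul, ← mul_assoc]
    rw [← Circle.coe_mul, ← AddChar.map_add_eq_mul]
    ring_nf
  simp only [h1, smul_eq_mul] at h
  rw [← h, Real.fourierInv_eq]
  refine integral_congr_ae (ae_of_all _ fun u ↦ ?_)
  simp only [RCLike.inner_apply, conj_trivial, Circle.smul_def, smul_eq_mul]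
  rw [mul_comm x u]
  change 𝓕 f u * _ = _
  ring

lemma integrable_mul_exp_neg_of_norm_le_one {f : ℝ → ℂ} (hf : Measurable f)
    (hb : ∀ t, ‖f t‖ ≤ 1) (h0 : ∀ t < 0, f t = 0) {σ : ℝ} (hσ : 0 < σ) :
    Integrable (fun t ↦ f t * Complex.exp (-(σ * t : ℂ))) := by
  have h : IntegrableOn (fun t : ℝ ↦ Real.exp (-σ * t)) (Ici 0) := by
    rw [integrableOn_Ici_iff_integrableOn_Ioi]
    exact integrableOn_exp_mul_Ioi (by linarith) 0
  refine (h.integrable_indicator measurableSet_Ici).mono'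
    (hf.mul (by fun_prop)).aestronglyMeasurable (ae_of_all _ fun t ↦ ?_)
  by_cases ht : t < 0
  · simp [h0 t ht, indicator, ht.not_ge]
  · rw [indicator_of_mem (by simpa using ht), norm_mul, Complex.norm_exp]
    simpa using mul_le_of_le_one_left (Real.exp_pos _).le (hb t)

lemma fourier_mul_exp_neg {f : ℝ → ℂ} (h0 : ∀ t < 0, f t = 0) (σ u : ℝ) :
    𝓕 (fun t : ℝ ↦ f t * Complex.exp (-(σ * t : ℂ))) u =
      ∫ t in Ioi (0 : ℝ), f t * Complex.exp (-((σ + 2 * π * u * Complex.I) * t)) := by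
  rw [Real.fourier_real_eq_integral_exp_smul, ← integral_Ici_eq_integral_Ioi,
    ← integral_indicator measurableSet_Ici]
  refine integral_congr_ae (ae_of_all _ fun t ↦ ?_)
  by_cases ht : t < 0
  · simp [h0 t ht, indicator, ht.not_ge]
  · simp only [smul_eq_mul]
    rw [indicator_of_mem (by simpa using ht), mul_left_comm, ← Complex.exp_add]
    push_cast
    ring_nf

/-- If the Laplace transform of a bounded function extends continuously to the closed right
half-plane, then the function has vanishing averages at infinity against every integrable kernel
whose Fourier transform is continuous with compact support. -/
theorem tendsto_integral_mul_fourierInv_of_laplace {f : ℝ → ℂ} {G : ℂ → ℂ} (hf : Measurable f)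
    (hb : ∀ t, ‖f t‖ ≤ 1) (h0 : ∀ t < 0, f t = 0) (hG : ContinuousOn G {z | 0 ≤ z.re})
    (hL : ∀ z : ℂ, 0 < z.re → ∫ t in Ioi (0 : ℝ), f t * Complex.exp (-(z * t)) = G z)
    {k : ℝ → ℂ} (hk : Continuous k) (hkc : HasCompactSupport k) (hki : Integrable (𝓕⁻ k)) :
    Tendsto (fun x : ℝ ↦ ∫ t, f t * 𝓕⁻ k (x - t)) atTop (𝓝 0) := by
  have hcont : Continuous (fun p : ℝ × ℝ ↦ G ((max p.1 0 : ℝ) + 2 * π * p.2 * Complex.I)) := by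
    refine hG.comp_continuous (by fun_prop) fun p ↦ ?_
    simp
  have hkint : Integrable k := hk.integrable_of_hasCompactSupport hkc
  have key : ∀ x : ℝ, ∫ t, f t * 𝓕⁻ k (x - t) =
      𝓕⁻ (fun u : ℝ ↦ G ((max (0 : ℝ) 0 : ℝ) + 2 * π * u * Complex.I) * k u) x := by
    intro x
    have hlim1 : Tendsto (fun σ : ℝ ↦ ∫ t, f t * Complex.exp (-(σ * t : ℂ)) * 𝓕⁻ k (x - t))
        (𝓝[>] 0) (𝓝 (∫ t, f t * 𝓕⁻ k (x - t))) := by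
      have hkx : Integrable (fun t ↦ 𝓕⁻ k (x - t)) := hki.comp_sub_left x
      refine tendsto_integral_filter_of_dominated_convergence (fun t ↦ ‖𝓕⁻ k (x - t)‖)
        (Eventually.of_forall fun σ ↦ ?_) ?_ hkx.norm (ae_of_all _ fun t ↦ ?_)
      · exact (hf.mul (by fun_prop)).aestronglyMeasurable.mul hkx.1
      · filter_upwards [self_mem_nhdsWithin] with σ (hσ : 0 < σ)
        refine ae_of_all _ fun t ↦ ?_
        rw [norm_mul]
        refine mul_le_of_le_one_left (norm_nonneg _) ?_
        by_cases ht : t < 0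
        · simp [h0 t ht]
        · rw [norm_mul, Complex.norm_exp]
          refine mul_le_one₀ (hb t) (Real.exp_pos _).le (Real.exp_le_one_iff.2 ?_)
          simpa using mul_nonneg hσ.le (not_lt.1 ht)
      · have : Continuous fun σ : ℝ ↦ f t * Complex.exp (-(σ * t : ℂ)) * 𝓕⁻ k (x - t) := by
          fun_prop
        simpa using (this.tendsto 0).mono_left nhdsWithin_le_nhds
    have hlim2 : Tendsto (fun σ : ℝ ↦
        𝓕⁻ (fun u : ℝ ↦ G ((max σ 0 : ℝ) + 2 * π * u * Complex.I) * k u) x) (𝓝[>] 0)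
        (𝓝 (𝓕⁻ (fun u : ℝ ↦ G ((max (0 : ℝ) 0 : ℝ) + 2 * π * u * Complex.I) * k u) x)) := by
      refine Tendsto.mono_left (Continuous.tendsto ?_ 0) nhdsWithin_le_nhds
      refine (continuous_parametric_integral_of_continuous (μ := volume) (f := fun σ u : ℝ ↦
        𝐞 (inner ℝ u x) • (G ((max σ 0 : ℝ) + 2 * π * u * Complex.I) * k u)) ?_ hkc).congr
        fun σ ↦ ?_
      · simp only [Function.uncurry_def, Circle.smul_def, smul_eq_mul, RCLike.inner_apply,
          conj_trivial]
        have he : Continuous fun p : ℝ × ℝ ↦ (𝐞 (x * p.2) : ℂ) :=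
          continuous_subtype_val.comp (Real.continuous_fourierChar.comp (by fun_prop))
        exact he.mul (hcont.mul (hk.comp continuous_snd))
      · rw [Real.fourierInv_eq]
        refine setIntegral_eq_integral_of_forall_compl_eq_zero fun u hu ↦ ?_
        simp [image_eq_zero_of_notMem_tsupport hu]
    refine tendsto_nhds_unique hlim1 (hlim2.congr' ?_)
    filter_upwards [self_mem_nhdsWithin] with σ (hσ : 0 < σ)
    rw [integral_mul_fourierInv_sub (integrable_mul_exp_neg_of_norm_le_one hf hb h0 hσ) hkint]
    refine congrArg (fun g : ℝ → ℂ ↦ 𝓕⁻ g x) (funext fun u ↦ ?_)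
    rw [fourier_mul_exp_neg h0, hL _ (by simpa using hσ), max_eq_left hσ.le]
  simp_rw [key, Real.fourierInv_eq_fourier_neg]
  exact ((Real.zero_at_infty_fourier _).mono_left atBot_le_cocompact).comp tendsto_neg_atTop_atBot

lemma exists_integrable_integral_eq_one_fourierInv : ∃ K : ℝ → ℂ, Integrable K ∧ ∫ v, K v = 1 ∧
    ∀ R : ℝ, 0 < R → ∃ k : ℝ → ℂ, Continuous k ∧ HasCompactSupport k ∧
      ∀ y, 𝓕⁻ k y = R * K (R * y) := by
  let b : ContDiffBump (0 : ℝ) := default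
  have hbc : HasCompactSupport (fun x ↦ (b x : ℂ)) :=
    b.hasCompactSupport.comp_left (g := Complex.ofReal) Complex.ofReal_zero
  have hbs : ContDiff ℝ ∞ (fun x ↦ (b x : ℂ)) := Complex.ofRealCLM.contDiff.comp b.contDiff
  let S : SchwartzMap ℝ ℂ := hbc.toSchwartzMap hbs
  have hS : ∀ x, S x = b x := fun x ↦ rfl
  refine ⟨(𝓕⁻ S : SchwartzMap ℝ ℂ), (𝓕⁻ S).integrable, ?_,
    fun R hR ↦ ⟨fun u ↦ S (u / R), by fun_prop, ?_, ?_⟩⟩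
  · have h : 𝓕 (𝓕⁻ S) 0 = S 0 := by rw [FourierTransform.fourier_fourierInv_eq]
    rw [SchwartzMap.fourier_coe, Real.fourier_real_eq] at h
    simpa [hS, b.one_of_mem_closedBall (Metric.mem_closedBall_self b.rIn_pos.le)] using h
  · exact hbc.comp_homeomorph (Homeomorph.mulRight₀ R⁻¹ (by positivity))
  · intro y
    rw [SchwartzMap.fourierInv_coe, Real.fourierInv_eq, Real.fourierInv_eq]
    have h := Measure.integral_comp_div (fun u : ℝ ↦ 𝐞 (inner ℝ u (R * y)) • S u) R
    rw [abs_of_pos hR, Complex.real_smul] at h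
    rw [← h]
    refine integral_congr_ae (ae_of_all _ fun u ↦ ?_)
    have huy : R * y * (u / R) = y * u := by field_simp
    simp only [RCLike.inner_apply, conj_trivial, huy]

/-- A bounded slowly oscillating function tends to zero at infinity as soon as its Laplace
transform extends continuously to the closed right half-plane. -/
theorem tendsto_zero_of_laplace {f : ℝ → ℂ} {G : ℂ → ℂ} (hf : Measurable f)
    (hb : ∀ t, ‖f t‖ ≤ 1) (h0 : ∀ t < 0, f t = 0) (hG : ContinuousOn G {z | 0 ≤ z.re})
    (hL : ∀ z : ℂ, 0 < z.re → ∫ t in Ioi (0 : ℝ), f t * Complex.exp (-(z * t)) = G z)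
    (hso : ∀ ε > 0, ∃ δ > 0, ∀ᶠ x in atTop, ∀ s, |s| < δ → ‖f (x - s) - f x‖ ≤ ε) :
    Tendsto f atTop (𝓝 0) := by
  obtain ⟨K, hK, hK1, hKR⟩ := exists_integrable_integral_eq_one_fourierInv
  rw [NormedAddGroup.tendsto_nhds_zero]
  intro ε hε
  set C := ∫ v, ‖K v‖
  have hC : 0 ≤ C := integral_nonneg fun v ↦ norm_nonneg _
  obtain ⟨δ, hδ, hδx⟩ := hso (ε / (4 * (C + 1))) (by positivity)
  have htail : Tendsto (fun R : ℝ ↦ ∫ v, {v : ℝ | δ * R ≤ |v|}.indicator (fun v ↦ ‖K v‖) v) atTop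
      (𝓝 (∫ _ : ℝ, (0 : ℝ))) := by
    refine tendsto_integral_filter_of_dominated_convergence (fun v ↦ ‖K v‖)
      (Eventually.of_forall fun R ↦ ?_) (Eventually.of_forall fun R ↦ ae_of_all _ fun v ↦ ?_)
      hK.norm (ae_of_all _ fun v ↦ ?_)
    · exact (hK.norm.indicator (measurableSet_le measurable_const (by fun_prop))).1
    · rw [norm_indicator_eq_indicator_norm]
      simp only [norm_norm]
      exact indicator_le_self' (fun _ _ ↦ norm_nonneg _) v
    · refine tendsto_const_nhds.congr' ?_
      filter_upwards [(tendsto_id.const_mul_atTop hδ).eventually_gt_atTop |v|] with R hR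
      rw [indicator_of_notMem]
      simpa using hR
  rw [integral_zero] at htail
  obtain ⟨R, hR, hRt⟩ := ((eventually_gt_atTop 0).and
    (htail.eventually_lt_const (show 0 < ε / 8 by positivity))).exists
  obtain ⟨k, hk, hkc, hkK⟩ := hKR R hR
  have hki : Integrable (𝓕⁻ k) := by
    have : 𝓕⁻ k = fun y ↦ R * K (R * y) := funext hkK
    rw [this]
    exact (hK.comp_mul_left' hR.ne').const_mul _
  have hconv := tendsto_integral_mul_fourierInv_of_laplace hf hb h0 hG hL hk hkc hki
  have hrw : ∀ x, ∫ t, f t * 𝓕⁻ k (x - t) = ∫ v, f (x - v / R) * K v := by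
    intro x
    rw [← integral_sub_left_eq_self _ volume x]
    simp only [hkK, sub_sub_cancel]
    have h := Measure.integral_comp_mul_left (fun v ↦ f (x - v / R) * K v) R
    simp only [mul_div_cancel_left₀ _ hR.ne', abs_inv, abs_of_pos hR, Complex.real_smul] at h
    simp_rw [mul_left_comm _ (R : ℂ), integral_const_mul, h]
    rw [← mul_assoc]
    push_cast
    rw [mul_inv_cancel₀ (by exact_mod_cast hR.ne'), one_mul]
  rw [NormedAddGroup.tendsto_nhds_zero] at hconv
  filter_upwards [hconv (ε / 4) (by positivity), hδx] with x hx1 hx2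
  rw [hrw] at hx1
  have hi : Integrable (fun v ↦ f (x - v / R) * K v) :=
    hK.bdd_mul (c := 1) (hf.comp (by fun_prop)).aestronglyMeasurable (ae_of_all _ fun v ↦ hb _)
  have hind : Integrable ({v : ℝ | δ * R ≤ |v|}.indicator (fun v ↦ ‖K v‖)) :=
    hK.norm.indicator (measurableSet_le measurable_const (by fun_prop))
  have hdiff : ‖∫ v, (f (x - v / R) - f x) * K v‖ ≤
      ∫ v, (ε / (4 * (C + 1)) * ‖K v‖ + 2 * {v : ℝ | δ * R ≤ |v|}.indicator (fun v ↦ ‖K v‖) v) := by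
    refine norm_integral_le_of_norm_le ((hK.norm.const_mul _).add (hind.const_mul _))
      (ae_of_all _ fun v ↦ ?_)
    rw [norm_mul]
    by_cases hv : δ * R ≤ |v|
    · rw [indicator_of_mem (by exact hv)]
      have : ‖f (x - v / R) - f x‖ ≤ 2 := by
        linarith [norm_sub_le (f (x - v / R)) (f x), hb (x - v / R), hb x]
      have := mul_le_mul_of_nonneg_right this (norm_nonneg (K v))
      have : 0 ≤ ε / (4 * (C + 1)) * ‖K v‖ := by positivity
      linarith
    · rw [indicator_of_notMem (by exact hv), mul_zero, add_zero]
      refine mul_le_mul_of_nonneg_right (hx2 _ ?_) (norm_nonneg _)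
      rw [abs_div, abs_of_pos hR, div_lt_iff₀ hR]
      exact not_le.1 hv
  rw [integral_add (hK.norm.const_mul _) (hind.const_mul _), integral_const_mul,
    integral_const_mul] at hdiff
  have hsplit : ∫ v, (f (x - v / R) - f x) * K v = (∫ v, f (x - v / R) * K v) - f x := by
    simp_rw [sub_mul]
    rw [integral_sub hi (hK.const_mul _), integral_const_mul, hK1, mul_one]
  rw [hsplit] at hdiff
  have hCb : ε / (4 * (C + 1)) * C ≤ ε / 4 := by
    rw [div_mul_eq_mul_div, div_le_div_iff₀ (by positivity) (by positivity)]
    nlinarith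
  have htri := norm_sub_norm_le (f x) (∫ v, f (x - v / R) * K v)
  rw [norm_sub_rev] at htri
  change _ ≤ ε / (4 * (C + 1)) * C + _ at hdiff
  linarith

end Tauberian

section Mertens

open ArithmeticFunction Topology

lemma norm_sum_moebius_sub_le (m n : ℕ) :
    ‖∑ k ∈ Finset.Icc 1 m, (moebius k : ℂ) - ∑ k ∈ Finset.Icc 1 n, (moebius k : ℂ)‖ ≤
      |(m : ℝ) - n| := by
  wlog h : n ≤ m generalizing m n
  · rw [norm_sub_rev, abs_sub_comm]
    exact this n m (le_of_not_ge h)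
  have hsub : Finset.Icc 1 n ⊆ Finset.Icc 1 m := Finset.Icc_subset_Icc_right h
  rw [← Finset.sum_sdiff hsub, add_sub_cancel_right]
  refine (norm_sum_le_of_le (n := fun _ ↦ (1 : ℝ)) _ fun k _ ↦ ?_).trans ?_
  · rw [Complex.norm_intCast]
    exact_mod_cast abs_moebius_le_one
  · rw [Finset.sum_const, Finset.card_sdiff_of_subset hsub, Nat.card_Icc, Nat.card_Icc, nsmul_one,
      Nat.add_sub_cancel, Nat.add_sub_cancel, Nat.cast_sub h]
    exact le_abs_self _

lemma norm_sum_moebius_le (n : ℕ) : ‖∑ k ∈ Finset.Icc 1 n, (moebius k : ℂ)‖ ≤ n := by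
  simpa using norm_sum_moebius_sub_le n 0

lemma LSeries_moebius_eq_mul_integral {s : ℂ} (hs : 1 < s.re) :
    LSeries (fun n ↦ (moebius n : ℂ)) s = s * ∫ t in Set.Ioi (1 : ℝ),
      (∑ k ∈ Finset.Icc 1 ⌊t⌋₊, (moebius k : ℂ)) * t ^ (-(s + 1)) := by
  refine LSeries_eq_mul_integral _ zero_le_one hs (LSeriesSummable_moebius_iff.2 hs) ?_
  refine Asymptotics.isBigO_of_le _ fun n ↦ ?_
  simpa using norm_sum_moebius_le n

lemma integral_exp_sum_moebius {z : ℂ} (hz : 0 < z.re) :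
    ∫ t in Set.Ioi (0 : ℝ), (∑ k ∈ Finset.Icc 1 ⌊exp t⌋₊, (moebius k : ℂ)) * (exp (-t) : ℝ) *
      Complex.exp (-(z * t)) = ((z + 1) * riemannZeta (z + 1))⁻¹ := by
  have hre : 1 < (z + 1).re := by simpa using hz
  have hz1 : z + 1 ≠ 0 := fun h ↦ by rw [h] at hre; norm_num at hre
  have h := LSeries_moebius_eq_mul_integral hre
  have hLs := LSeries_one_mul_Lseries_moebius hre
  rw [LSeries_one_eq_riemannZeta hre] at hLs
  rw [mul_inv, ← eq_inv_of_mul_eq_one_right hLs, h, inv_mul_cancel_left₀ hz1,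
    ← Real.exp_zero, ← MeasureTheory.integral_comp_exp_Ioi]
  refine MeasureTheory.integral_congr_ae (MeasureTheory.ae_of_all _ fun t ↦ ?_)
  simp only [Complex.real_smul, Complex.ofReal_exp]
  rw [Complex.cpow_def_of_ne_zero (Complex.exp_ne_zero _), Complex.log_exp
    (by simpa using pi_pos) (by simpa using pi_pos.le), mul_left_comm,
    ← Complex.exp_add, mul_assoc, ← Complex.exp_add]
  push_cast
  ring_nf

/-- The reciprocal of `(z + 1) ζ(z + 1)` extends continuously to the closed right half-plane. -/
lemma exists_continuousOn_inv_riemannZeta : ∃ G : ℂ → ℂ, ContinuousOn G {z | 0 ≤ z.re} ∧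
    ∀ z : ℂ, z ≠ 0 → G z = ((z + 1) * riemannZeta (z + 1))⁻¹ := by
  set h : ℂ → ℂ := Function.update (fun z ↦ (z + 1) * (z * riemannZeta (z + 1))) 0 1 with hdef
  have hne : ∀ z, z ≠ 0 → h z = (z + 1) * (z * riemannZeta (z + 1)) := fun z hz ↦ by
    simp [hdef, hz]
  have hcont : ContinuousOn h {z | 0 ≤ z.re} := by
    intro z hz
    refine ContinuousAt.continuousWithinAt ?_
    rcases eq_or_ne z 0 with rfl | hz0
    · rw [hdef, continuousAt_update_same]
      have h1 : Tendsto (fun z : ℂ ↦ z + 1) (𝓝[≠] 0) (𝓝[≠] 1) := by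
        refine tendsto_nhdsWithin_iff.2 ⟨?_, ?_⟩
        · exact ((continuous_add_const (1 : ℂ)).tendsto' 0 1 (zero_add 1)).mono_left
            nhdsWithin_le_nhds
        · filter_upwards [self_mem_nhdsWithin] with z hz
          simpa using hz
      have h2 := (h1.mono_right nhdsWithin_le_nhds).mul (riemannZeta_residue_one.comp h1)
      simpa [Function.comp_def] using h2
    · have hd : ContinuousAt riemannZeta (z + 1) :=
        (differentiableAt_riemannZeta (by simpa using hz0)).continuousAt
      have : ContinuousAt (fun z ↦ (z + 1) * (z * riemannZeta (z + 1))) z :=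
        (by fun_prop : ContinuousAt (fun z : ℂ ↦ z + 1) z).mul
          (continuousAt_id.mul (ContinuousAt.comp (f := fun z ↦ z + 1) hd (by fun_prop)))
      refine this.congr ?_
      filter_upwards [isOpen_ne.mem_nhds hz0] with w hw using (hne w hw).symm
  have hnz : ∀ z ∈ {z : ℂ | 0 ≤ z.re}, h z ≠ 0 := by
    intro z (hz : 0 ≤ z.re)
    rcases eq_or_ne z 0 with rfl | hz0
    · simp [hdef]
    · rw [hne z hz0]
      have hre : 1 ≤ (z + 1).re := by simpa using hz
      have hz1 : z + 1 ≠ 0 := fun h ↦ by rw [h] at hre; norm_num at hre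
      exact mul_ne_zero hz1 (mul_ne_zero hz0 (riemannZeta_ne_zero_of_one_le_re hre))
  refine ⟨fun z ↦ z * (h z)⁻¹, continuousOn_id.mul (hcont.inv₀ hnz), fun z hz ↦ ?_⟩
  simp only [hne z hz]
  rw [mul_left_comm, mul_inv, mul_inv_cancel_left₀ hz]

lemma norm_exp_sum_moebius_sub_le (x s : ℝ) :
    ‖(∑ k ∈ Finset.Icc 1 ⌊exp (x - s)⌋₊, (moebius k : ℂ)) * (exp (-(x - s)) : ℝ) -
      (∑ k ∈ Finset.Icc 1 ⌊exp x⌋₊, (moebius k : ℂ)) * (exp (-x) : ℝ)‖ ≤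
      2 * |exp (-s) - 1| + exp (-x) := by
  set a := exp (x - s) with ha
  set b := exp x with hb
  have hapos : 0 < a := exp_pos _
  have hbpos : 0 < b := exp_pos _
  have hab : |a - b| / b = |exp (-s) - 1| := by
    rw [← abs_of_pos hbpos, ← abs_div, abs_of_pos hbpos, sub_div, div_self hbpos.ne', ha, hb,
      ← exp_sub, sub_sub_cancel_left]
  rw [Real.exp_neg (x - s), Real.exp_neg x, ← ha, ← hb, ← hab]
  set A := ∑ k ∈ Finset.Icc 1 ⌊a⌋₊, (moebius k : ℂ)
  set B := ∑ k ∈ Finset.Icc 1 ⌊b⌋₊, (moebius k : ℂ)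
  have hA : ‖A‖ ≤ a := (norm_sum_moebius_le _).trans (Nat.floor_le hapos.le)
  have hAB : ‖A - B‖ ≤ |a - b| + 1 := by
    refine (norm_sum_moebius_sub_le _ _).trans ?_
    have := Nat.floor_le hapos.le
    have := Nat.floor_le hbpos.le
    have := Nat.lt_floor_add_one a
    have := Nat.lt_floor_add_one b
    rw [abs_le]
    constructor <;> cases abs_cases (a - b) <;> linarith
  have hdecomp : A * (a⁻¹ : ℝ) - B * (b⁻¹ : ℝ) =
      A * ((a⁻¹ - b⁻¹ : ℝ) : ℂ) + (A - B) * (b⁻¹ : ℝ) := by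
    push_cast
    ring
  rw [hdecomp]
  refine (norm_add_le _ _).trans ?_
  rw [norm_mul, norm_mul, Complex.norm_real, Complex.norm_real, norm_eq_abs, norm_eq_abs,
    abs_of_pos (inv_pos.2 hbpos)]
  have h1 : a * |a⁻¹ - b⁻¹| = |a - b| / b := by
    rw [inv_sub_inv hapos.ne' hbpos.ne', abs_div, abs_of_pos (mul_pos hapos hbpos), abs_sub_comm]
    field_simp
  have h2 : ‖A‖ * |a⁻¹ - b⁻¹| ≤ |a - b| / b :=
    h1 ▸ mul_le_mul_of_nonneg_right hA (abs_nonneg _)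
  have h3 : ‖A - B‖ * b⁻¹ ≤ (|a - b| + 1) * b⁻¹ :=
    mul_le_mul_of_nonneg_right hAB (inv_pos.2 hbpos).le
  rw [add_mul, one_mul, ← div_eq_mul_inv |a - b|] at h3
  linarith

/-- The Mertens function is `o(n)`, an equivalent form of the prime number theorem. -/
theorem tendsto_sum_moebius_div :
    Tendsto (fun n : ℕ ↦ (∑ k ∈ Finset.Icc 1 n, (moebius k : ℝ)) / n) atTop (𝓝 0) := by
  obtain ⟨G, hG, hGz⟩ := exists_continuousOn_inv_riemannZeta
  set f : ℝ → ℂ := fun t ↦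
    (∑ k ∈ Finset.Icc 1 ⌊exp t⌋₊, (moebius k : ℂ)) * (exp (-t) : ℝ) with hf
  have hlim : Tendsto f atTop (𝓝 0) := by
    refine tendsto_zero_of_laplace (G := G) ?_ (fun t ↦ ?_) (fun t ht ↦ ?_) hG (fun z hz ↦ ?_) ?_
    · refine Measurable.mul ?_ (by fun_prop)
      exact (measurable_from_nat (f := fun n ↦ ∑ k ∈ Finset.Icc 1 n, (moebius k : ℂ))).comp
        (Nat.measurable_floor.comp Real.measurable_exp)
    · rw [hf]
      simp only
      rw [norm_mul, Complex.norm_real, norm_eq_abs, abs_of_pos (exp_pos _), exp_neg,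
        ← div_eq_mul_inv, div_le_one (exp_pos _)]
      exact (norm_sum_moebius_le _).trans (Nat.floor_le (exp_pos _).le)
    · have : ⌊exp t⌋₊ = 0 := Nat.floor_eq_zero.2 (exp_lt_one_iff.2 ht)
      simp [hf, this]
    · rw [hGz z fun h ↦ by simp [h] at hz]
      exact integral_exp_sum_moebius hz
    · intro ε hε
      have hcont : Tendsto (fun s : ℝ ↦ 2 * |exp (-s) - 1|) (𝓝 0) (𝓝 0) := by
        have : Continuous fun s : ℝ ↦ 2 * |exp (-s) - 1| := by fun_prop
        exact this.tendsto' 0 0 (by simp)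
      obtain ⟨δ, hδ, hδs⟩ := Metric.eventually_nhds_iff.1
        (hcont.eventually_lt_const (show 0 < ε / 2 by positivity))
      refine ⟨δ, hδ, ?_⟩
      have hx : Tendsto (fun x : ℝ ↦ exp (-x)) atTop (𝓝 0) := tendsto_exp_neg_atTop_nhds_zero
      filter_upwards [hx.eventually_lt_const (show 0 < ε / 2 by positivity)] with x hx s hs
      have := hδs (y := s) (by simpa using hs)
      exact (norm_exp_sum_moebius_sub_le x s).trans (by linarith)
  have h := (hlim.comp (tendsto_log_atTop.comp tendsto_natCast_atTop_atTop)).norm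
  rw [tendsto_zero_iff_norm_tendsto_zero]
  rw [norm_zero] at h
  refine h.congr' ?_
  filter_upwards [eventually_gt_atTop 0] with n hn
  have hn' : (0 : ℝ) < n := by exact_mod_cast hn
  simp only [Function.comp_apply, hf, exp_neg, exp_log hn', Nat.floor_natCast, div_eq_mul_inv]
  rw [← Complex.norm_real]
  push_cast
  rfl

end Mertens

section Squarefree

open ArithmeticFunction Topology

lemma Squarefree.sq_dvd_sq_mul_iff {a b d : ℕ} (ha : Squarefree a) (hb : b ≠ 0) :
    d ^ 2 ∣ b ^ 2 * a ↔ d ∣ b := by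
  refine ⟨fun h ↦ ?_, fun h ↦ (pow_dvd_pow_of_dvd h 2).mul_right a⟩
  have hba : b ^ 2 * a ≠ 0 := mul_ne_zero (pow_ne_zero 2 hb) ha.ne_zero
  have hd : d ≠ 0 := by
    rintro rfl
    exact hba (by simpa using h)
  rw [← Nat.factorization_le_iff_dvd (pow_ne_zero 2 hd) hba] at h
  rw [← Nat.factorization_le_iff_dvd hd hb]
  intro p
  have hp := h p
  have hap := ha.natFactorization_le_one p
  rw [Nat.factorization_mul (pow_ne_zero 2 hb) ha.ne_zero, Nat.factorization_pow,
    Nat.factorization_pow] at hp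
  simp only [Finsupp.smul_apply, Finsupp.add_apply, smul_eq_mul] at hp
  lia

lemma sum_moebius_sq_dvd {n N : ℕ} (hn : 0 < n) (hN : n ≤ N) :
    ∑ d ∈ Finset.Icc 1 N with d ^ 2 ∣ n, moebius d = if Squarefree n then 1 else 0 := by
  obtain ⟨a, b, rfl, ha⟩ := Nat.sq_mul_squarefree n
  have hb : b ≠ 0 := by
    rintro rfl
    simp at hn
  have hbN : b ≤ N := by
    calc b ≤ b ^ 2 * a := by
          have : 1 ≤ a := Nat.one_le_iff_ne_zero.2 ha.ne_zero
          have : 1 ≤ b := Nat.one_le_iff_ne_zero.2 hb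
          nlinarith
      _ ≤ N := hN
  have hfilter : (Finset.Icc 1 N).filter (fun d ↦ d ^ 2 ∣ b ^ 2 * a) = b.divisors := by
    ext d
    simp only [Finset.mem_filter, Finset.mem_Icc, ha.sq_dvd_sq_mul_iff hb, Nat.mem_divisors]
    refine ⟨fun h ↦ ⟨h.2, hb⟩, fun h ↦ ⟨⟨Nat.pos_of_dvd_of_pos h.1 (by lia), ?_⟩, h.1⟩⟩
    exact (Nat.le_of_dvd (by lia) h.1).trans hbN
  have hsq : Squarefree (b ^ 2 * a) ↔ b = 1 := by
    refine ⟨fun h ↦ Nat.isUnit_iff.1 (h b ⟨a, by ring⟩), ?_⟩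
    rintro rfl
    simpa using ha
  rw [hfilter, ← coe_zeta_mul_apply, coe_zeta_mul_moebius, one_apply]
  simp only [hsq]

lemma card_squarefree_Icc (N : ℕ) : (((Finset.Icc 1 N).filter Squarefree).card : ℤ) =
    ∑ d ∈ Finset.Icc 1 N, moebius d * (N / d ^ 2 : ℕ) := by
  rw [Finset.card_filter, Nat.cast_sum]
  simp only [Nat.cast_ite, Nat.cast_one, Nat.cast_zero]
  rw [Finset.sum_congr rfl fun n hn ↦ (sum_moebius_sq_dvd (Finset.mem_Icc.1 hn).1
    (Finset.mem_Icc.1 hn).2).symm]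
  simp_rw [Finset.sum_filter]
  rw [Finset.sum_comm]
  refine Finset.sum_congr rfl fun d _ ↦ ?_
  rw [← Finset.sum_filter, Finset.sum_const, nsmul_eq_mul, mul_comm,
    ← Nat.Ioc_filter_dvd_card_eq_div]
  rfl

lemma hasSum_moebius_div_sq : HasSum (fun d : ℕ ↦ (moebius d : ℝ) / d ^ 2) (6 / π ^ 2) := by
  have h2 : 1 < (2 : ℂ).re := by norm_num
  have h := (LSeriesSummable_moebius_iff.2 h2).hasSum
  have hLs := LSeries_one_mul_Lseries_moebius h2
  rw [LSeries_one_eq_riemannZeta h2, riemannZeta_two] at hLs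
  change HasSum _ (LSeries _ _) at h
  rw [eq_inv_of_mul_eq_one_right hLs, inv_div] at h
  rw [← Complex.hasSum_ofReal]
  push_cast
  refine h.congr_fun fun d ↦ ?_
  rcases eq_or_ne d 0 with rfl | hd
  · simp
  · rw [LSeries.term_of_ne_zero hd]
    norm_cast

theorem tendsto_card_squarefree_div :
    Tendsto (fun N : ℕ ↦ (((Finset.Icc 1 N).filter Squarefree).card : ℝ) / N) atTop
      (𝓝 (6 / π ^ 2)) := by
  have hsum : ∀ N : ℕ, (((Finset.Icc 1 N).filter Squarefree).card : ℝ) / N =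
      ∑' d : ℕ, (moebius d : ℝ) * ((N / d ^ 2 : ℕ) / N) := by
    intro N
    rw [tsum_eq_sum (s := Finset.Icc 1 N)]
    · have := congrArg (Int.cast (R := ℝ)) (card_squarefree_Icc N)
      rw [Int.cast_natCast, Int.cast_sum] at this
      simp only [Int.cast_mul, Int.cast_natCast] at this
      rw [this, Finset.sum_div]
      exact Finset.sum_congr rfl fun d _ ↦ by rw [mul_div_assoc]
    · intro d hd
      rcases Nat.eq_zero_or_pos d with rfl | hd0
      · simp
      · have : N < d ^ 2 := by
          have hNd : N < d := by simpa [hd0, Nat.one_le_iff_ne_zero, hd0.ne'] using hd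
          nlinarith
        simp [Nat.div_eq_of_lt this]
  simp_rw [hsum]
  rw [← hasSum_moebius_div_sq.tsum_eq]
  refine tendsto_tsum_of_dominated_convergence (bound := fun d : ℕ ↦ 1 / (d : ℝ) ^ 2)
    (Real.summable_one_div_nat_pow.2 one_lt_two) (fun d ↦ ?_) (Eventually.of_forall fun N d ↦ ?_)
  · rw [div_eq_mul_inv]
    refine tendsto_const_nhds.mul ?_
    have h := (tendsto_nat_floor_mul_div_atTop (R := ℝ) (a := ((d : ℝ) ^ 2)⁻¹)
      (by positivity)).comp tendsto_natCast_atTop_atTop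
    refine h.congr fun N ↦ ?_
    simp only [Function.comp_apply]
    rw [inv_mul_eq_div, ← Nat.cast_pow, Nat.floor_div_natCast, Nat.floor_natCast]
  · have hmu : |(moebius d : ℝ)| ≤ 1 := by exact_mod_cast abs_moebius_le_one
    rw [norm_mul, norm_eq_abs, norm_eq_abs]
    have hq : |((N / d ^ 2 : ℕ) : ℝ) / N| ≤ 1 / (d : ℝ) ^ 2 := by
      rw [abs_of_nonneg (by positivity)]
      have h := Nat.cast_div_le (α := ℝ) (m := N) (n := d ^ 2)
      rcases Nat.eq_zero_or_pos N with rfl | hN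
      · simp
      · rw [div_le_iff₀ (by exact_mod_cast hN)]
        refine h.trans_eq ?_
        push_cast
        ring
    calc _ ≤ 1 * (1 / (d : ℝ) ^ 2) := by gcongr
      _ = _ := one_mul _

end Squarefree

theorem moebius_eq_one_density :
    Tendsto (fun n : ℕ =>
      (((Finset.Icc 1 n).filter (fun i => ArithmeticFunction.moebius i = 1)).card : ℝ) / n)
      atTop (nhds (3 / π ^ 2)) := by
  have hcard : ∀ n : ℕ,
      (((Finset.Icc 1 n).filter (fun i => ArithmeticFunction.moebius i = 1)).card : ℝ) =
        ((((Finset.Icc 1 n).filter Squarefree).card : ℝ) +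
          ∑ k ∈ Finset.Icc 1 n, (ArithmeticFunction.moebius k : ℝ)) / 2 := by
    intro n
    rw [Finset.card_filter, Finset.card_filter]
    push_cast
    rw [← Finset.sum_add_distrib, Finset.sum_div]
    refine Finset.sum_congr rfl fun k _ ↦ ?_
    by_cases hk : Squarefree k
    · rcases ArithmeticFunction.moebius_ne_zero_iff_eq_or.1
        (ArithmeticFunction.moebius_ne_zero_iff_squarefree.2 hk) with h | h <;> norm_num [h, hk]
    · simp [ArithmeticFunction.moebius_eq_zero_of_not_squarefree hk, hk]
  have h := (tendsto_card_squarefree_div.add tendsto_sum_moebius_div).div_const 2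
  rw [show (6 / π ^ 2 + 0) / 2 = 3 / π ^ 2 by ring] at h
  refine h.congr fun n ↦ ?_
  rw [hcard]
  ring
end

section
/- For every ε > 0 there exists N such that for all n ≥ N, the number ω(n) of distinct prime divisors of n satisfies ω(n) ≤ (1 + ε)·(log n)/(log log n). (The maximal number of prime divisors of a natural number n is asymptotically at most log n / log log n.) -/
open Filter Real

/-- Splitting the prime factors of `n` at `y`: at most `y` of them are `≤ y`, and the others have
product at most `n`. -/
theorem card_primeFactors_le_add_log_div_log {n : ℕ} (hn : n ≠ 0) {y : ℝ} (hy : 1 < y) :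
    (n.primeFactors.card : ℝ) ≤ y + Real.log n / Real.log y := by
  have small : ((n.primeFactors.filter fun p : ℕ => (p : ℝ) ≤ y).card : ℝ) ≤ y := by
    have hsub : (n.primeFactors.filter fun p : ℕ => (p : ℝ) ≤ y) ⊆ Finset.Icc 1 ⌊y⌋₊ := by
      intro p hp
      rw [Finset.mem_filter] at hp
      exact Finset.mem_Icc.2 ⟨(Nat.prime_of_mem_primeFactors hp.1).one_le, Nat.le_floor hp.2⟩
    have hcard := Finset.card_le_card hsub
    rw [Nat.card_Icc, Nat.add_sub_cancel] at hcard
    exact (Nat.cast_le.2 hcard).trans (Nat.floor_le (by linarith))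
  have large : ((n.primeFactors.filter fun p : ℕ => ¬ (p : ℝ) ≤ y).card : ℝ)
      ≤ Real.log n / Real.log y := by
    rw [le_div_iff₀ (Real.log_pos hy), ← nsmul_eq_mul]
    calc _ ≤ ∑ p ∈ n.primeFactors.filter (fun p : ℕ => ¬ (p : ℝ) ≤ y), Real.log p := by
          refine Finset.card_nsmul_le_sum _ _ _ fun p hp => ?_
          exact Real.log_le_log (by linarith) (not_le.1 (Finset.mem_filter.1 hp).2).le
      _ ≤ ∑ p ∈ n.primeFactors, Real.log p :=
          Finset.sum_le_sum_of_subset_of_nonneg (Finset.filter_subset _ _)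
            fun p _ _ => Real.log_natCast_nonneg p
      _ = Real.log ((∏ p ∈ n.primeFactors, p : ℕ) : ℝ) := by
          rw [Nat.cast_prod, Real.log_prod]
          intro p hp
          exact_mod_cast (Nat.prime_of_mem_primeFactors hp).ne_zero
      _ ≤ Real.log n := by
          have hdvd := Nat.prod_primeFactors_dvd n
          refine Real.log_le_log ?_ (Nat.cast_le.2 (Nat.le_of_dvd (Nat.pos_of_ne_zero hn) hdvd))
          exact Nat.cast_pos.2 (Nat.pos_of_dvd_of_pos hdvd (Nat.pos_of_ne_zero hn))
  rw [← Finset.card_filter_add_card_filter_not (s := n.primeFactors) fun p : ℕ => (p : ℝ) ≤ y]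
  push_cast
  exact add_le_add small large

theorem omega_le_log_div_loglog :
    ∀ ε : ℝ, 0 < ε → ∃ N : ℕ, ∀ n : ℕ, N ≤ n →
      (n.primeFactors.card : ℝ) ≤ (1 + ε) * Real.log n / Real.log (Real.log n) := by
  intro ε hε
  set a : ℝ := (1 + ε / 2)⁻¹ with ha
  have ha0 : 0 < a := by positivity
  have ha1 : a < 1 := inv_lt_one_of_one_lt₀ (by linarith)
  have hlog : ∀ᶠ L : ℝ in atTop, ‖Real.log L‖ ≤ ε / 2 * ‖L ^ (1 - a)‖ :=
    (isLittleO_log_rpow_atTop (sub_pos.2 ha1)).bound (half_pos hε)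
  have hL : Tendsto (fun n : ℕ => Real.log n) atTop atTop :=
    Real.tendsto_log_atTop.comp tendsto_natCast_atTop_atTop
  obtain ⟨N, hN⟩ := eventually_atTop.1
    ((hL.eventually (hlog.and (eventually_gt_atTop 1))).and (eventually_ne_atTop 0))
  refine ⟨N, fun n hn => ?_⟩
  obtain ⟨⟨hbound, h1⟩, hn0⟩ := hN n hn
  set L := Real.log n
  have hL0 : 0 < L := by linarith
  have hlogL : 0 < Real.log L := Real.log_pos h1
  rw [Real.norm_of_nonneg hlogL.le, Real.norm_of_nonneg (by positivity)] at hbound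
  have hpow : L ^ a ≤ ε / 2 * L / Real.log L := by
    rw [le_div_iff₀ hlogL]
    calc L ^ a * Real.log L ≤ L ^ a * (ε / 2 * L ^ (1 - a)) := by gcongr
      _ = ε / 2 * (L ^ a * L ^ (1 - a)) := by ring
      _ = ε / 2 * L := by rw [← Real.rpow_add hL0, add_sub_cancel, Real.rpow_one]
  calc (n.primeFactors.card : ℝ) ≤ L ^ a + L / Real.log (L ^ a) :=
        card_primeFactors_le_add_log_div_log hn0 (Real.one_lt_rpow h1 ha0)
    _ ≤ ε / 2 * L / Real.log L + L / (a * Real.log L) := by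
        rw [Real.log_rpow hL0]
        gcongr
    _ = (1 + ε) * L / Real.log L := by
        rw [ha]
        field_simp
        ring
end

section
/- For every fixed integer k ≥ 1, #{i : 1 ≤ i ≤ n, ω(i) = k} is asymptotic to n·(log log n)^{k-1} / ((k-1)!·log n) as n → ∞; that is, the ratio of the two quantities tends to 1. (Landau's theorem on integers with exactly k prime factors, equation (3.6); the case k = 1 recovers the prime number theorem.) -/
open Filter Real

section LandauPrimeFactors

open MeasureTheory Set Topology

/-- The triangle function supported on `[-2, 2]`. -/
noncomputable def triangle (t : ℝ) : ℝ := max 0 (2 - |t|)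

lemma continuous_triangle : Continuous triangle := by unfold triangle; fun_prop

lemma triangle_nonneg (t : ℝ) : 0 ≤ triangle t := le_max_left _ _

lemma triangle_eq_zero {t : ℝ} (ht : 2 ≤ |t|) : triangle t = 0 := by
  unfold triangle; exact max_eq_left (by linarith)

lemma hasCompactSupport_triangle : HasCompactSupport triangle :=
  HasCompactSupport.intro (isCompact_Icc (a := (-2 : ℝ)) (b := 2)) fun _ hx ↦
    triangle_eq_zero (not_lt.mp fun h ↦ hx (abs_le.mp h.le))

lemma integrable_triangle : Integrable triangle :=
  continuous_triangle.integrable_of_hasCompactSupport hasCompactSupport_triangle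

/-- The Fejér kernel, the Fourier transform of the triangle function. -/
noncomputable def fejer (v : ℝ) : ℝ := 4 * sinc v ^ 2

lemma fejer_nonneg (v : ℝ) : 0 ≤ fejer v := by unfold fejer; positivity

lemma continuous_fejer : Continuous fejer := by
  unfold fejer; have := continuous_sinc; fun_prop

lemma fejer_le (v : ℝ) : fejer v ≤ 8 * (1 + v ^ 2)⁻¹ := by
  unfold fejer
  rw [← div_eq_mul_inv, le_div_iff₀ (by positivity)]
  have h1 : sinc v ^ 2 ≤ 1 := by
    rw [sq_le_one_iff_abs_le_one]; exact abs_sinc_le_one v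
  have h2 : v ^ 2 * sinc v ^ 2 ≤ 1 := by
    rcases eq_or_ne v 0 with rfl | hv
    · simp
    · rw [sinc_of_ne_zero hv, ← mul_pow, mul_div_cancel₀ _ hv]
      exact sin_sq_le_one v
  nlinarith

lemma integrable_fejer : Integrable fejer := by
  refine (integrable_inv_one_add_sq.const_mul 8).mono' continuous_fejer.aestronglyMeasurable ?_
  filter_upwards with v
  rw [norm_of_nonneg (fejer_nonneg v)]
  exact fejer_le v

lemma integral_fejer_pos : 0 < ∫ v, fejer v := by
  refine integral_pos_of_integrable_nonneg_nonzero (x := 0) continuous_fejer integrable_fejer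
    fejer_nonneg ?_
  simp [fejer]

lemma integral_triangle_mul_exp {v : ℝ} (hv : v ≠ 0) :
    ∫ t : ℝ, (triangle t : ℂ) * Complex.exp (Complex.I * t * v) = fejer v := by
  have key (w : ℝ) (hw : w ≠ 0) : ∫ t in (0 : ℝ)..2, (triangle t : ℂ) *
      Complex.exp (Complex.I * t * w) =
      Complex.exp (Complex.I * 2 * w) / (Complex.I * w) ^ 2 - 2 / (Complex.I * w)
        - 1 / (Complex.I * w) ^ 2 := by
    have hw' : (w : ℂ) ≠ 0 := by exact_mod_cast hw
    have hIw : Complex.I * w ≠ 0 := mul_ne_zero Complex.I_ne_zero hw'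
    have hd (t : ℝ) : HasDerivAt (fun t : ℝ ↦ (2 - (t : ℂ)) * Complex.exp (Complex.I * t * w) /
        (Complex.I * w) + Complex.exp (Complex.I * t * w) / (Complex.I * w) ^ 2)
        ((2 - (t : ℂ)) * Complex.exp (Complex.I * t * w)) t := by
      have h0 : HasDerivAt (fun t : ℝ ↦ (t : ℂ)) 1 t := Complex.ofRealCLM.hasDerivAt
      have h1 : HasDerivAt (fun t : ℝ ↦ Complex.exp (Complex.I * t * w))
          (Complex.exp (Complex.I * t * w) * (Complex.I * 1 * w)) t :=
        ((h0.const_mul Complex.I).mul_const (w : ℂ)).cexp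
      have h2 := (((h0.const_sub 2).mul h1).div_const (Complex.I * w)).add
        (h1.div_const ((Complex.I * w) ^ 2))
      refine h2.congr_deriv ?_
      field_simp
      ring
    have hcongr : ∫ t in (0 : ℝ)..2, (triangle t : ℂ) * Complex.exp (Complex.I * t * w) =
        ∫ t in (0 : ℝ)..2, (2 - (t : ℂ)) * Complex.exp (Complex.I * t * w) := by
      refine intervalIntegral.integral_congr fun t ht ↦ ?_
      rw [uIcc_of_le (by norm_num)] at ht
      have : triangle t = 2 - t := by
        unfold triangle; rw [abs_of_nonneg ht.1]; exact max_eq_right (by linarith [ht.2])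
      simp [this]
    rw [hcongr, intervalIntegral.integral_eq_sub_of_hasDerivAt (fun t _ ↦ hd t)
      (Continuous.intervalIntegrable (by fun_prop) _ _)]
    simp
    ring
  have hcont (w : ℝ) : Continuous fun t : ℝ ↦ (triangle t : ℂ) *
      Complex.exp (Complex.I * t * w) := by
    have := continuous_triangle; fun_prop
  have hsupp : Function.support (fun t : ℝ ↦ (triangle t : ℂ) *
      Complex.exp (Complex.I * t * v)) ⊆ Ioc (-2) 2 := by
    intro t ht
    by_contra h
    refine ht ?_
    have : 2 ≤ |t| := by
      by_contra! h2
      exact h ⟨(abs_lt.mp h2).1, (abs_lt.mp h2).2.le⟩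
    simp [triangle_eq_zero this]
  have hneg : ∫ t in (-2 : ℝ)..0, (triangle t : ℂ) * Complex.exp (Complex.I * t * v) =
      ∫ t in (0 : ℝ)..2, (triangle t : ℂ) * Complex.exp (Complex.I * t * (-v : ℝ)) := by
    have := intervalIntegral.integral_comp_neg (a := 0) (b := 2)
      (fun t : ℝ ↦ (triangle t : ℂ) * Complex.exp (Complex.I * t * v))
    rw [neg_zero] at this
    rw [← this]
    refine intervalIntegral.integral_congr fun t _ ↦ ?_
    simp [triangle]
  rw [← intervalIntegral.integral_eq_integral_of_support_subset hsupp,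
    ← intervalIntegral.integral_add_adjacent_intervals (b := 0)
      ((hcont v).intervalIntegrable _ _) ((hcont v).intervalIntegrable _ _), hneg, key v hv,
    key (-v) (neg_ne_zero.mpr hv), fejer, sinc_of_ne_zero hv]
  have hv' : (v : ℂ) ≠ 0 := by exact_mod_cast hv
  push_cast
  rw [Complex.sin]
  have e1 : Complex.exp (Complex.I * 2 * v) = Complex.exp (v * Complex.I) ^ 2 := by
    rw [← Complex.exp_nat_mul]; congr 1; push_cast; ring
  have e2 : Complex.exp (Complex.I * 2 * -v) = Complex.exp (-v * Complex.I) ^ 2 := by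
    rw [← Complex.exp_nat_mul]; congr 1; push_cast; ring
  have e3 : Complex.exp (v * Complex.I) * Complex.exp (-v * Complex.I) = 1 := by
    rw [← Complex.exp_add]; simp
  rw [e1, e2]
  set a := Complex.exp (v * Complex.I)
  set b := Complex.exp (-v * Complex.I)
  have hI0 := Complex.I_ne_zero
  field_simp
  rw [Complex.I_pow_four]
  linear_combination (8 : ℂ) * e3

lemma integral_triangle_div_mul_exp {r : ℝ} (hr : 0 < r) {v : ℝ} (hv : v ≠ 0) :
    ∫ t : ℝ, (triangle (t / r) : ℂ) * Complex.exp (Complex.I * t * v) =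
      ((r * fejer (r * v) : ℝ) : ℂ) := by
  have h := Measure.integral_comp_div
    (fun t : ℝ ↦ (triangle t : ℂ) * Complex.exp (Complex.I * t * (r * v : ℝ))) r
  rw [integral_triangle_mul_exp (mul_ne_zero hr.ne' hv), abs_of_pos hr] at h
  rw [Complex.ofReal_mul, ← Complex.real_smul, ← h]
  congr 1
  ext t
  have : (r : ℂ) ≠ 0 := by exact_mod_cast hr.ne'
  congr 2
  push_cast
  field_simp

section Tauberian

variable {B : ℝ → ℝ} {C : ℝ} {G : ℂ → ℂ}

lemma continuous_comp_vertical_line (hG : ContinuousOn G {s | 0 ≤ s.re}) {ε : ℝ} (hε : 0 ≤ ε) :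
    Continuous fun t : ℝ ↦ G (ε + Complex.I * t) :=
  hG.comp_continuous (by fun_prop) fun t ↦ by simpa using hε

lemma integrable_fejer_comp {r : ℝ} (hr : 0 < r) (y : ℝ) :
    Integrable fun u ↦ r * fejer (r * (y - u)) := by
  have h := (integrable_fejer.comp_mul_left' hr.ne').comp_sub_left y
  exact h.const_mul r

lemma integral_triangle_mul_laplace (hBm : Measurable B) (hB : ∀ u, |B u - 1| ≤ C)
    (hL : ∀ s : ℂ, 0 < s.re →
      ∫ u in Ioi (0 : ℝ), ((B u - 1 : ℝ) : ℂ) * Complex.exp (-s * u) = G s)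
    {r : ℝ} (hr : 0 < r) (y : ℝ) {ε : ℝ} (hε : 0 < ε) :
    ∫ t : ℝ, (triangle (t / r) : ℂ) * Complex.exp (Complex.I * t * y) * G (ε + Complex.I * t) =
      ∫ u in Ioi (0 : ℝ), (((B u - 1) * exp (-ε * u) * (r * fejer (r * (y - u))) : ℝ) : ℂ) := by
  set F : ℝ → ℝ → ℂ := fun t u ↦ (triangle (t / r) : ℂ) * Complex.exp (Complex.I * t * y) *
    (((B u - 1 : ℝ) : ℂ) * Complex.exp (-(ε + Complex.I * t) * u)) with hF
  have htri : Integrable fun t ↦ triangle (t / r) := integrable_triangle.comp_div hr.ne'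
  have hexp : Integrable (fun u ↦ C * exp (-ε * u)) (volume.restrict (Ioi 0)) :=
    (integrableOn_exp_mul_Ioi (neg_neg_of_pos hε) 0).const_mul C
  have hint : Integrable (Function.uncurry F) (volume.prod (volume.restrict (Ioi (0 : ℝ)))) := by
    refine (htri.mul_prod hexp).mono' ?_ ?_
    · have := continuous_triangle
      refine Measurable.aestronglyMeasurable ?_
      have h1 : Measurable fun p : ℝ × ℝ ↦ ((B p.2 - 1 : ℝ) : ℂ) :=
        Complex.measurable_ofReal.comp ((hBm.comp measurable_snd).sub_const 1)
      have h2 : Continuous fun p : ℝ × ℝ ↦ (triangle (p.1 / r) : ℂ) *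
        Complex.exp (Complex.I * p.1 * y) := by fun_prop
      have h3 : Continuous fun p : ℝ × ℝ ↦ Complex.exp (-(ε + Complex.I * p.1) * p.2) := by
        fun_prop
      exact h2.measurable.mul (h1.mul h3.measurable)
    · filter_upwards with p
      simp only [Function.uncurry, hF, norm_mul, Complex.norm_exp, Complex.norm_real]
      rw [norm_of_nonneg (triangle_nonneg _)]
      have e1 : (Complex.I * p.1 * y).re = 0 := by simp
      have e2 : (-(ε + Complex.I * p.1) * (p.2 : ℂ)).re = -ε * p.2 := by simp
      rw [e1, e2, exp_zero, mul_one]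
      have := hB p.2
      have := triangle_nonneg (p.1 / r)
      rw [norm_eq_abs]
      gcongr
  calc _ = ∫ t : ℝ, ∫ u in Ioi (0 : ℝ), F t u := by
        refine integral_congr_ae (.of_forall fun t ↦ ?_)
        simp only [hF]
        rw [integral_const_mul, hL _ (by simpa using hε)]
    _ = ∫ u in Ioi (0 : ℝ), ∫ t : ℝ, F t u := integral_integral_swap hint
    _ = _ := by
        refine integral_congr_ae ?_
        have hne : ∀ᵐ u ∂(volume.restrict (Ioi (0 : ℝ))), u ≠ y :=
          ae_restrict_of_ae (Measure.ae_ne volume y)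
        filter_upwards [hne] with u hu
        have h := integral_triangle_div_mul_exp hr (sub_ne_zero.mpr hu.symm)
        push_cast at h ⊢
        rw [← h, ← integral_const_mul]
        congr 1
        ext t
        simp only [hF]
        have : Complex.exp (-(ε + Complex.I * t) * u) * Complex.exp (Complex.I * t * y) =
            Complex.exp (-ε * u) * Complex.exp (Complex.I * t * (y - u)) := by
          rw [← Complex.exp_add, ← Complex.exp_add]; congr 1; ring
        push_cast
        linear_combination (triangle (t / r) : ℂ) * (B u - 1) * this

lemma integral_triangle_mul_boundary (hBm : Measurable B) (hB : ∀ u, |B u - 1| ≤ C)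
    (hG : ContinuousOn G {s | 0 ≤ s.re})
    (hL : ∀ s : ℂ, 0 < s.re →
      ∫ u in Ioi (0 : ℝ), ((B u - 1 : ℝ) : ℂ) * Complex.exp (-s * u) = G s)
    {r : ℝ} (hr : 0 < r) (y : ℝ) :
    ∫ t : ℝ, (triangle (t / r) : ℂ) * Complex.exp (Complex.I * t * y) * G (Complex.I * t) =
      ∫ u in Ioi (0 : ℝ), (((B u - 1) * (r * fejer (r * (y - u))) : ℝ) : ℂ) := by
  have hpos : ∀ᶠ ε : ℝ in 𝓝[>] 0, 0 < ε := eventually_mem_nhdsWithin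
  have hle : ∀ᶠ ε : ℝ in 𝓝[>] 0, ε ≤ 1 :=
    eventually_nhdsWithin_of_eventually_nhds (eventually_le_nhds zero_lt_one)
  have hid : Tendsto (fun ε : ℝ ↦ ε) (𝓝[>] 0) (𝓝 0) := tendsto_id.mono_left nhdsWithin_le_nhds
  obtain ⟨M, hM⟩ := (isCompact_Icc.reProdIm isCompact_Icc :
    IsCompact (Icc (0 : ℝ) 1 ×ℂ Icc (-(2 * r)) (2 * r))).exists_bound_of_continuousOn
    (hG.mono fun s hs ↦ (Complex.mem_reProdIm.mp hs).1.1)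
  have hleft : Tendsto (fun ε : ℝ ↦ ∫ t : ℝ, (triangle (t / r) : ℂ) *
      Complex.exp (Complex.I * t * y) * G (ε + Complex.I * t)) (𝓝[>] 0)
      (𝓝 (∫ t : ℝ, (triangle (t / r) : ℂ) * Complex.exp (Complex.I * t * y) *
        G (Complex.I * t))) := by
    have htri : Integrable fun t ↦ triangle (t / r) := integrable_triangle.comp_div hr.ne'
    refine tendsto_integral_filter_of_dominated_convergence _ ?_ ?_ (htri.mul_const M) ?_
    · filter_upwards [hpos] with ε hε
      have := continuous_triangle
      exact Continuous.aestronglyMeasurable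
        (.mul (by fun_prop) (continuous_comp_vertical_line hG hε.le))
    · filter_upwards [hpos, hle] with ε hε hε1
      filter_upwards with t
      rw [norm_mul, norm_mul, Complex.norm_exp, Complex.norm_real,
        norm_of_nonneg (triangle_nonneg _)]
      have e1 : (Complex.I * t * y).re = 0 := by simp
      rw [e1, exp_zero, mul_one]
      by_cases ht : 2 ≤ |t / r|
      · simp [triangle_eq_zero ht]
      · have ht' : |t| ≤ 2 * r := by
          rw [not_le, abs_div, abs_of_pos hr, div_lt_iff₀ hr] at ht
          exact ht.le
        refine mul_le_mul_of_nonneg_left (hM _ ?_) (triangle_nonneg _)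
        rw [Complex.mem_reProdIm]
        simpa using ⟨⟨hε.le, hε1⟩, abs_le.mp ht'⟩
    · filter_upwards with t
      refine Tendsto.const_mul _ ?_
      have h0 : Tendsto (fun ε : ℝ ↦ (ε : ℂ) + Complex.I * t) (𝓝[>] 0)
          (𝓝[{s | 0 ≤ s.re}] (Complex.I * t)) := by
        refine tendsto_nhdsWithin_iff.mpr ⟨?_, ?_⟩
        · have : Tendsto (fun ε : ℝ ↦ (ε : ℂ)) (𝓝[>] 0) (𝓝 ((0 : ℝ) : ℂ)) :=
            (Complex.continuous_ofReal.tendsto 0).comp hid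
          simpa using this.add_const (Complex.I * t)
        · filter_upwards [hpos] with ε hε
          simpa using hε.le
      exact (hG (Complex.I * t) (by simp)).tendsto.comp h0
  have hright : Tendsto (fun ε : ℝ ↦ ∫ u in Ioi (0 : ℝ),
      (((B u - 1) * exp (-ε * u) * (r * fejer (r * (y - u))) : ℝ) : ℂ)) (𝓝[>] 0)
      (𝓝 (∫ u in Ioi (0 : ℝ), (((B u - 1) * (r * fejer (r * (y - u))) : ℝ) : ℂ))) := by
    have hk := (integrable_fejer_comp hr y).const_mul C
    refine tendsto_integral_filter_of_dominated_convergence _ ?_ ?_ hk.restrict ?_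
    · refine .of_forall fun ε ↦ Measurable.aestronglyMeasurable ?_
      have := continuous_fejer.measurable
      fun_prop
    · filter_upwards [hpos] with ε hε
      filter_upwards [ae_restrict_mem measurableSet_Ioi] with u hu
      have hu : 0 < u := hu
      rw [Complex.norm_real, norm_mul, norm_mul, norm_eq_abs, norm_of_nonneg (exp_nonneg _),
        norm_of_nonneg (mul_nonneg hr.le (fejer_nonneg _))]
      refine mul_le_mul_of_nonneg_right ?_ (mul_nonneg hr.le (fejer_nonneg _))
      have : exp (-ε * u) ≤ 1 := exp_le_one_iff.mpr (by nlinarith)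
      nlinarith [hB u, abs_nonneg (B u - 1), exp_nonneg (-ε * u)]
    · filter_upwards with u
      refine (Complex.continuous_ofReal.tendsto _).comp ?_
      refine Tendsto.mul_const _ ?_
      have : Tendsto (fun ε : ℝ ↦ exp (-ε * u)) (𝓝[>] 0) (𝓝 (exp (-0 * u))) :=
        ((by fun_prop : Continuous fun ε : ℝ ↦ exp (-ε * u)).tendsto 0).comp hid
      simpa using this.const_mul (B u - 1)
  refine tendsto_nhds_unique hleft (hright.congr' ?_)
  filter_upwards [hpos] with ε hε
  exact (integral_triangle_mul_laplace hBm hB hL hr y hε).symm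

lemma tendsto_integral_sub_one_mul_fejer (hBm : Measurable B) (hB : ∀ u, |B u - 1| ≤ C)
    (hG : ContinuousOn G {s | 0 ≤ s.re})
    (hL : ∀ s : ℂ, 0 < s.re →
      ∫ u in Ioi (0 : ℝ), ((B u - 1 : ℝ) : ℂ) * Complex.exp (-s * u) = G s)
    {r : ℝ} (hr : 0 < r) :
    Tendsto (fun y ↦ ∫ u in Ioi (0 : ℝ), (B u - 1) * (r * fejer (r * (y - u)))) atTop (𝓝 0) := by
  have hw : Tendsto (fun y : ℝ ↦ -(y / (2 * π))) atTop (cocompact ℝ) :=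
    (tendsto_neg_atTop_atBot.comp (tendsto_id.atTop_div_const two_pi_pos)).mono_right
      atBot_le_cocompact
  have h := (Real.tendsto_integral_exp_smul_cocompact
    fun t : ℝ ↦ (triangle (t / r) : ℂ) * G (Complex.I * t)).comp hw
  refine ((Complex.continuous_re.tendsto 0).comp h).congr fun y ↦ ?_
  simp only [Function.comp_apply]
  have := integral_triangle_mul_boundary hBm hB hG hL hr y
  rw [integral_complex_ofReal] at this
  rw [← Complex.ofReal_re (∫ u in Ioi (0 : ℝ), _), ← this]
  refine congrArg Complex.re (integral_congr_ae (.of_forall fun t ↦ ?_))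
  dsimp only
  rw [Circle.smul_def, Real.fourierChar_apply, smul_eq_mul]
  have : (2 * π * -(t * -(y / (2 * π))) : ℝ) = t * y := by
    field_simp
  rw [this]
  push_cast
  rw [show (t * y * Complex.I : ℂ) = Complex.I * t * y by ring]
  ring

lemma integral_mul_fejer_comp (g : ℝ → ℝ) {r : ℝ} (hr : 0 < r) (y : ℝ) :
    ∫ u, g u * (r * fejer (r * (y - u))) = ∫ v, g (y - v / r) * fejer v := by
  have h1 := integral_sub_left_eq_self
    (fun w ↦ r * (g (y - r * w / r) * fejer (r * w))) volume y
  have h2 := Measure.integral_comp_mul_left (fun v ↦ r * (g (y - v / r) * fejer v)) r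
  rw [integral_const_mul r fun v ↦ g (y - v / r) * fejer v, abs_of_pos (inv_pos.mpr hr),
    smul_eq_mul, inv_mul_cancel_left₀ hr.ne'] at h2
  rw [← h2, ← h1]
  congr 1
  ext u
  rw [mul_div_cancel_left₀ _ hr.ne', sub_sub_cancel]
  ring

lemma integrable_mul_fejer (hBm : Measurable B) (hB : ∀ u, |B u| ≤ C) (r y : ℝ) :
    Integrable fun v ↦ B (y - v / r) * fejer v :=
  integrable_fejer.bdd_mul (c := C) (Measurable.aestronglyMeasurable (by fun_prop))
    (.of_forall fun v ↦ hB _)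

lemma tendsto_integral_mul_fejer (hBm : Measurable B) (hB : ∀ u, |B u - 1| ≤ C)
    (hB0 : ∀ u ≤ 0, B u = 0)
    (hG : ContinuousOn G {s | 0 ≤ s.re})
    (hL : ∀ s : ℂ, 0 < s.re →
      ∫ u in Ioi (0 : ℝ), ((B u - 1 : ℝ) : ℂ) * Complex.exp (-s * u) = G s)
    {r : ℝ} (hr : 0 < r) :
    Tendsto (fun y ↦ ∫ v, B (y - v / r) * fejer v) atTop (𝓝 (∫ v, fejer v)) := by
  have hind : Tendsto (fun y ↦ ∫ v, (Ioi 0).indicator (fun _ ↦ (1 : ℝ)) (y - v / r) * fejer v)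
      atTop (𝓝 (∫ v, fejer v)) := by
    refine tendsto_integral_filter_of_dominated_convergence fejer ?_ ?_ integrable_fejer ?_
    · refine .of_forall fun y ↦ Measurable.aestronglyMeasurable ?_
      exact ((measurable_const.indicator measurableSet_Ioi).comp (by fun_prop)).mul
        continuous_fejer.measurable
    · refine .of_forall fun y ↦ .of_forall fun v ↦ ?_
      rw [norm_mul, norm_of_nonneg (fejer_nonneg v)]
      refine mul_le_of_le_one_left (fejer_nonneg v) ?_
      refine (norm_indicator_le_norm_self _ _).trans (by simp)
    · filter_upwards with v
      refine tendsto_const_nhds.congr' ?_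
      filter_upwards [eventually_gt_atTop (v / r)] with y hy
      rw [indicator_of_mem (by simpa using hy), one_mul]
  refine (((tendsto_integral_sub_one_mul_fejer hBm hB hG hL hr).add hind).congr fun y ↦ ?_).trans
    (by rw [zero_add])
  have hk := integrable_fejer_comp hr y
  have hBb (u : ℝ) : |B u| ≤ C + 1 := by
    have := hB u; rw [abs_le] at this ⊢; constructor <;> linarith
  have hBk : Integrable fun u ↦ B u * (r * fejer (r * (y - u))) :=
    hk.bdd_mul (c := C + 1) hBm.aestronglyMeasurable (.of_forall fun u ↦ hBb u)
  rw [← integral_mul_fejer_comp B hr, ← integral_mul_fejer_comp _ hr]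
  simp_rw [sub_mul, one_mul]
  rw [integral_sub hBk.restrict hk.restrict]
  have e1 : ∫ u in Ioi (0 : ℝ), B u * (r * fejer (r * (y - u))) =
      ∫ u, B u * (r * fejer (r * (y - u))) :=
    setIntegral_eq_integral_of_forall_compl_eq_zero fun u hu ↦ by
      rw [hB0 u (not_lt.mp hu), zero_mul]
  have e2 : ∫ u, (Ioi 0).indicator (fun _ ↦ (1 : ℝ)) u * (r * fejer (r * (y - u))) =
      ∫ u in Ioi (0 : ℝ), r * fejer (r * (y - u)) := by
    rw [← integral_indicator measurableSet_Ioi]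
    congr 1
    ext u
    simp only [indicator_apply, ite_mul, one_mul, zero_mul]
  rw [e1, e2, sub_add_cancel]

lemma eventually_bounds_of_tendsto_fejer (hBm : Measurable B) (hnn : ∀ u, 0 ≤ B u)
    (hB : ∀ u, B u ≤ C) (hmono : Monotone fun u ↦ exp u * B u)
    (hF : ∀ r > 0, Tendsto (fun y ↦ ∫ v, B (y - v / r) * fejer v) atTop (𝓝 (∫ v, fejer v)))
    {δ : ℝ} (hδ : 0 < δ) (hδ1 : δ < 1) :
    ∀ᶠ y in atTop, exp (-δ) * (1 - δ - C * δ) ≤ B y ∧ B y ≤ exp δ * ((1 + δ) / (1 - δ)) := by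
  set I := ∫ v, fejer v
  have hI : 0 < I := integral_fejer_pos
  have hlim := intervalIntegral_tendsto_integral integrable_fejer tendsto_neg_atTop_atBot
    tendsto_id
  have hlt : (1 - δ) * I < I := by nlinarith
  obtain ⟨M, hM, hM0⟩ := ((hlim.eventually (lt_mem_nhds hlt)).and (eventually_gt_atTop 0)).exists
  simp only [id_eq] at hM
  rw [intervalIntegral.integral_of_le (by linarith)] at hM
  set r := 2 * M / δ
  have hr : 0 < r := by positivity
  have hvr {v : ℝ} (hv : v ∈ Ioc (-M) M) : -(δ / 2) ≤ v / r ∧ v / r ≤ δ / 2 := by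
    have : δ / 2 = M / r := by simp only [r]; field_simp
    rw [this, ← neg_div]
    exact ⟨by gcongr; exact hv.1.le, by gcongr; exact hv.2⟩
  have hFint (y : ℝ) : Integrable fun v ↦ B (y - v / r) * fejer v :=
    integrable_mul_fejer (C := C) hBm (fun u ↦ by rw [abs_of_nonneg (hnn u)]; exact hB u) r y
  have hup : (I : ℝ) < (1 + δ) * I := by nlinarith
  have hexp : exp (-δ) * exp δ = 1 := by rw [← exp_add]; simp
  have hupper : ∀ᶠ y in atTop, B (y - δ / 2) ≤ exp δ * ((1 + δ) / (1 - δ)) := by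
    filter_upwards [(hF r hr).eventually (gt_mem_nhds hup)] with y hy
    have h1 : ∫ v in Ioc (-M) M, B (y - δ / 2) * exp (-δ) * fejer v ≤
        ∫ v in Ioc (-M) M, B (y - v / r) * fejer v := by
      refine setIntegral_mono_on (integrable_fejer.const_mul _).integrableOn
        (hFint y).integrableOn measurableSet_Ioc fun v hv ↦ ?_
      refine mul_le_mul_of_nonneg_right ?_ (fejer_nonneg v)
      have h2 : exp (y - δ / 2) * B (y - δ / 2) ≤ exp (y - v / r) * B (y - v / r) :=
        hmono (by linarith [(hvr hv).2])
      have h3 : exp (y - v / r) ≤ exp (y - δ / 2) * exp δ := by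
        rw [← exp_add]; exact exp_le_exp.mpr (by linarith [(hvr hv).1])
      have h4 : exp (y - δ / 2) * B (y - δ / 2) ≤
          exp (y - δ / 2) * (exp δ * B (y - v / r)) := by
        refine h2.trans ?_
        rw [← mul_assoc]
        exact mul_le_mul_of_nonneg_right h3 (hnn _)
      have h5 := le_of_mul_le_mul_left h4 (exp_pos _)
      calc _ ≤ exp δ * B (y - v / r) * exp (-δ) :=
            mul_le_mul_of_nonneg_right h5 (exp_nonneg _)
        _ = B (y - v / r) := by linear_combination (B (y - v / r)) * hexp
    rw [integral_const_mul] at h1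
    have h6 : ∫ v in Ioc (-M) M, B (y - v / r) * fejer v ≤ ∫ v, B (y - v / r) * fejer v :=
      setIntegral_le_integral (hFint y)
        (.of_forall fun v ↦ mul_nonneg (hnn _) (fejer_nonneg v))
    have h7 : B (y - δ / 2) * exp (-δ) * ((1 - δ) * I) ≤ (1 + δ) * I :=
      (mul_le_mul_of_nonneg_left hM.le (mul_nonneg (hnn _) (exp_nonneg _))).trans
        (h1.trans (h6.trans hy.le))
    have h8 : B (y - δ / 2) * exp (-δ) * (1 - δ) ≤ 1 + δ := by
      refine le_of_mul_le_mul_right ?_ hI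
      linarith
    have h9 : B (y - δ / 2) * exp (-δ) ≤ (1 + δ) / (1 - δ) :=
      (le_div_iff₀ (by linarith)).mpr h8
    calc B (y - δ / 2) = exp δ * (B (y - δ / 2) * exp (-δ)) := by
          linear_combination (-B (y - δ / 2)) * hexp
      _ ≤ _ := mul_le_mul_of_nonneg_left h9 (exp_nonneg _)
  have hlower : ∀ᶠ y in atTop, exp (-δ) * (1 - δ - C * δ) ≤ B (y + δ / 2) := by
    filter_upwards [(hF r hr).eventually (lt_mem_nhds hlt)] with y hy
    rw [← integral_add_compl (measurableSet_Ioc (a := -M) (b := M)) (hFint y)] at hy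
    have h1 : ∫ v in Ioc (-M) M, B (y - v / r) * fejer v ≤
        ∫ v in Ioc (-M) M, exp δ * B (y + δ / 2) * fejer v := by
      refine setIntegral_mono_on (hFint y).integrableOn
        (integrable_fejer.const_mul _).integrableOn measurableSet_Ioc fun v hv ↦ ?_
      refine mul_le_mul_of_nonneg_right ?_ (fejer_nonneg v)
      have h2 : exp (y - v / r) * B (y - v / r) ≤ exp (y + δ / 2) * B (y + δ / 2) :=
        hmono (by linarith [(hvr hv).1])
      have h3 : exp (y + δ / 2) ≤ exp (y - v / r) * exp δ := by
        rw [← exp_add]; exact exp_le_exp.mpr (by linarith [(hvr hv).2])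
      refine le_of_mul_le_mul_left (h2.trans ?_) (exp_pos (y - v / r))
      rw [← mul_assoc]
      exact mul_le_mul_of_nonneg_right h3 (hnn _)
    have h1' : ∫ v in Ioc (-M) M, exp δ * B (y + δ / 2) * fejer v ≤
        exp δ * B (y + δ / 2) * I := by
      rw [integral_const_mul]
      exact mul_le_mul_of_nonneg_left
        (setIntegral_le_integral integrable_fejer (.of_forall fejer_nonneg))
        (mul_nonneg (exp_nonneg _) (hnn _))
    have h2 : ∫ v in (Ioc (-M) M)ᶜ, B (y - v / r) * fejer v ≤
        C * ∫ v in (Ioc (-M) M)ᶜ, fejer v := by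
      rw [← integral_const_mul]
      exact setIntegral_mono (hFint y).integrableOn (integrable_fejer.const_mul _).integrableOn
        fun v ↦ mul_le_mul_of_nonneg_right (hB _) (fejer_nonneg v)
    have h3 : ∫ v in (Ioc (-M) M)ᶜ, fejer v ≤ δ * I := by
      have := integral_add_compl (measurableSet_Ioc (a := -M) (b := M)) integrable_fejer
      linarith
    have hC : 0 ≤ C := (hnn 0).trans (hB 0)
    have h4 : (1 - δ - C * δ) * I ≤ exp δ * B (y + δ / 2) * I := by
      nlinarith [mul_le_mul_of_nonneg_left h3 hC]
    have h5 := le_of_mul_le_mul_right h4 hI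
    calc _ ≤ exp (-δ) * (exp δ * B (y + δ / 2)) :=
          mul_le_mul_of_nonneg_left h5 (exp_nonneg _)
      _ = _ := by linear_combination (B (y + δ / 2)) * hexp
  have t1 : Tendsto (fun y : ℝ ↦ y + δ / 2) atTop atTop :=
    tendsto_atTop_add_const_right _ _ tendsto_id
  have t2 : Tendsto (fun y : ℝ ↦ y - δ / 2) atTop atTop :=
    tendsto_atTop_add_const_right _ _ tendsto_id
  filter_upwards [t1.eventually hupper, t2.eventually hlower] with y h1 h2
  simp only [add_sub_cancel_right, sub_add_cancel] at h1 h2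
  exact ⟨h2, h1⟩

/-- A Wiener–Ikehara type Tauberian theorem for bounded functions. -/
theorem tendsto_one_of_laplace_continuous (hnn : ∀ u, 0 ≤ B u)
    (hB : ∀ u, B u ≤ C) (hB0 : ∀ u ≤ 0, B u = 0) (hmono : Monotone fun u ↦ exp u * B u)
    (hG : ContinuousOn G {s | 0 ≤ s.re})
    (hL : ∀ s : ℂ, 0 < s.re →
      ∫ u in Ioi (0 : ℝ), ((B u - 1 : ℝ) : ℂ) * Complex.exp (-s * u) = G s) :
    Tendsto B atTop (𝓝 1) := by
  have hBm : Measurable B := by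
    have h : B = fun u ↦ exp (-u) * (exp u * B u) := by
      ext u; rw [← mul_assoc, ← exp_add]; simp
    rw [h]
    exact (by fun_prop : Measurable fun u ↦ exp (-u)).mul hmono.measurable
  have hB1 (u : ℝ) : |B u - 1| ≤ C + 1 := by
    have := hB u; have := hnn u
    rw [abs_le]; constructor <;> linarith
  have key {δ : ℝ} (hδ : 0 < δ) (hδ1 : δ < 1) :=
    eventually_bounds_of_tendsto_fejer hBm hnn hB hmono
      (fun r hr ↦ tendsto_integral_mul_fejer hBm hB1 hB0 hG hL hr) hδ hδ1
  have hpos : ∀ᶠ δ : ℝ in 𝓝[>] 0, 0 < δ := eventually_mem_nhdsWithin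
  have hlt : ∀ᶠ δ : ℝ in 𝓝[>] 0, δ < 1 :=
    eventually_nhdsWithin_of_eventually_nhds (eventually_lt_nhds zero_lt_one)
  have c1 : Tendsto (fun δ : ℝ ↦ exp (-δ) * (1 - δ - C * δ)) (𝓝[>] 0) (𝓝 1) := by
    have : Continuous fun δ : ℝ ↦ exp (-δ) * (1 - δ - C * δ) := by fun_prop
    simpa using (this.tendsto 0).mono_left nhdsWithin_le_nhds
  have c2 : Tendsto (fun δ : ℝ ↦ exp δ * ((1 + δ) / (1 - δ))) (𝓝[>] 0) (𝓝 1) := by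
    have : ContinuousAt (fun δ : ℝ ↦ exp δ * ((1 + δ) / (1 - δ))) 0 := by
      fun_prop (disch := norm_num)
    simpa using this.tendsto.mono_left nhdsWithin_le_nhds
  refine tendsto_order.mpr ⟨fun a ha ↦ ?_, fun a ha ↦ ?_⟩
  · obtain ⟨δ, h, h0, h1⟩ := ((c1.eventually (lt_mem_nhds ha)).and (hpos.and hlt)).exists
    filter_upwards [key h0 h1] with y hy using h.trans_le hy.1
  · obtain ⟨δ, h, h0, h1⟩ := ((c2.eventually (gt_mem_nhds ha)).and (hpos.and hlt)).exists
    filter_upwards [key h0 h1] with y hy using hy.2.trans_lt h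

end Tauberian

open scoped ArithmeticFunction.vonMangoldt in
open ArithmeticFunction.vonMangoldt in
lemma laplace_psi {s : ℂ} (hs : 0 < s.re) :
    ∫ u in Ioi (0 : ℝ), ((Chebyshev.psi (exp u) * exp (-u) - 1 : ℝ) : ℂ) *
      Complex.exp (-s * u) = (LFunctionResidueClassAux (1 : ZMod 1) (1 + s) - 1) / (1 + s) := by
  have hs1 : 1 < (1 + s).re := by simpa using hs
  have hs0 : s ≠ 0 := fun h ↦ by simp [h] at hs
  have hs1' : 1 + s ≠ 0 := fun h ↦ by rw [h] at hs1; norm_num at hs1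
  have hO : (fun n ↦ ∑ k ∈ Finset.Icc 1 n, Λ k) =O[atTop] fun n : ℕ ↦ (n : ℝ) ^ (1 : ℝ) := by
    refine Asymptotics.IsBigO.of_bound (Real.log 4 + 4) (.of_forall fun n ↦ ?_)
    have h := Chebyshev.psi_le_const_mul_self (Nat.cast_nonneg (α := ℝ) n)
    have h0 := Chebyshev.psi_nonneg n
    rw [Chebyshev.psi, Nat.floor_natCast] at h h0
    rwa [show Finset.Icc 1 n = Finset.Ioc 0 n from rfl, rpow_one, norm_of_nonneg h0,
      norm_of_nonneg (Nat.cast_nonneg n)]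
  have hS := LSeries_eq_mul_integral_of_nonneg (fun n ↦ Λ n) zero_le_one hs1 hO
    fun _ ↦ ArithmeticFunction.vonMangoldt_nonneg
  have hE := eqOn_LFunctionResidueClassAux (q := 1) (a := 1) isUnit_one hs1
  have hres : (residueClass (1 : ZMod 1)) = fun n ↦ Λ n := by
    ext n
    exact indicator_of_mem (show n ∈ {n : ℕ | (n : ZMod 1) = 1} from Subsingleton.elim _ _) _
  simp only [hres, Nat.totient_one, Nat.cast_one, inv_one, add_sub_cancel_left] at hE
  rw [hE, hS, show Ioi (1 : ℝ) = Ioi (exp 0) by rw [exp_zero], ← integral_comp_exp_Ioi]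
  have hcongr (u : ℝ) : exp u • ((∑ k ∈ Finset.Icc 1 ⌊exp u⌋₊, (Λ k : ℂ)) *
      (exp u : ℂ) ^ (-(1 + s + 1))) =
      ((Chebyshev.psi (exp u) * exp (-u) : ℝ) : ℂ) * Complex.exp (-s * u) := by
    have h1 : (exp u : ℂ) ^ (-(1 + s + 1)) = Complex.exp (-u) * Complex.exp (-u) *
        Complex.exp (-s * u) := by
      rw [Complex.cpow_def_of_ne_zero (by exact_mod_cast (exp_pos u).ne'), ← Complex.ofReal_log
        (exp_nonneg u), log_exp, ← Complex.exp_add, ← Complex.exp_add]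
      congr 1
      ring
    have h2 : Complex.exp u * Complex.exp (-u) = 1 := by rw [← Complex.exp_add]; simp
    have h3 : ((Chebyshev.psi (exp u) : ℝ) : ℂ) = ∑ k ∈ Finset.Icc 1 ⌊exp u⌋₊, (Λ k : ℂ) := by
      rw [Chebyshev.psi]; push_cast; rfl
    rw [h1, Complex.real_smul, Complex.ofReal_mul, h3]
    push_cast
    linear_combination (∑ k ∈ Finset.Icc 1 ⌊exp u⌋₊, (Λ k : ℂ)) * Complex.exp (-u) *
      Complex.exp (-s * u) * h2
  simp_rw [hcongr]
  have hexp : IntegrableOn (fun u : ℝ ↦ Complex.exp (-s * u)) (Ioi 0) :=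
    integrableOn_exp_mul_complex_Ioi (by simpa using hs) 0
  have hpsi : IntegrableOn (fun u : ℝ ↦ ((Chebyshev.psi (exp u) * exp (-u) : ℝ) : ℂ) *
      Complex.exp (-s * u)) (Ioi 0) := by
    refine Integrable.bdd_mul (c := log 4 + 4) hexp ?_ (.of_forall fun u ↦ ?_)
    · have := Chebyshev.psi_mono.measurable
      exact Measurable.aestronglyMeasurable (by fun_prop)
    · rw [Complex.norm_real, norm_of_nonneg (mul_nonneg (Chebyshev.psi_nonneg _) (exp_nonneg _)),
        exp_neg, ← div_eq_mul_inv, div_le_iff₀ (exp_pos u)]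
      exact Chebyshev.psi_le_const_mul_self (exp_nonneg u)
  have hval := integral_exp_mul_complex_Ioi (a := -s) (by simpa using hs) 0
  simp only [Complex.ofReal_zero, mul_zero, Complex.exp_zero] at hval
  simp only [Complex.ofReal_sub, Complex.ofReal_one, sub_mul, one_mul]
  rw [integral_sub hpsi hexp, hval]
  field_simp
  ring

/-- The **Prime Number Theorem** for Chebyshev's function `ψ`. -/
theorem tendsto_psi_div_self : Tendsto (fun x ↦ Chebyshev.psi x / x) atTop (𝓝 1) := by
  open ArithmeticFunction.vonMangoldt in
  have h := tendsto_one_of_laplace_continuous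
    (B := fun u ↦ Chebyshev.psi (exp u) * exp (-u)) (C := log 4 + 4)
    (G := fun s ↦ (LFunctionResidueClassAux (1 : ZMod 1) (1 + s) - 1) / (1 + s))
    (fun u ↦ mul_nonneg (Chebyshev.psi_nonneg _) (exp_nonneg _))
    (fun u ↦ by
      rw [exp_neg, ← div_eq_mul_inv, div_le_iff₀ (exp_pos u)]
      exact Chebyshev.psi_le_const_mul_self (exp_nonneg u))
    (fun u hu ↦ by
      rw [Chebyshev.psi_eq_zero_of_le_one (exp_le_one_iff.mpr hu), zero_mul])
    (fun u v huv ↦ by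
      have e (w : ℝ) : exp w * (Chebyshev.psi (exp w) * exp (-w)) = Chebyshev.psi (exp w) := by
        rw [mul_left_comm, ← exp_add]; simp
      simp only [e]
      exact Chebyshev.psi_mono (exp_le_exp.mpr huv))
    (by
      refine ContinuousOn.div (ContinuousOn.sub ?_ continuousOn_const) (by fun_prop) ?_
      · exact (continuousOn_LFunctionResidueClassAux (1 : ZMod 1)).comp (by fun_prop)
          fun s hs ↦ by simpa using hs
      · intro s hs h
        have := congrArg Complex.re h
        simp only [Complex.add_re, Complex.one_re, Complex.zero_re] at this
        linarith [show 0 ≤ s.re from hs])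
    (fun s hs ↦ laplace_psi hs)
  refine (h.comp tendsto_log_atTop).congr' ?_
  filter_upwards [eventually_gt_atTop 0] with x hx
  simp only [Function.comp_apply]
  rw [exp_neg, exp_log hx, div_eq_mul_inv]

theorem tendsto_theta_div_self : Tendsto (fun x ↦ Chebyshev.theta x / x) atTop (𝓝 1) := by
  have h : Tendsto (fun x ↦ (Chebyshev.psi - Chebyshev.theta) x / x) atTop (𝓝 0) := by
    refine Asymptotics.IsLittleO.tendsto_div_nhds_zero
      (Chebyshev.isBigO_psi_sub_theta_sqrt.trans_isLittleO ?_)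
    refine (Asymptotics.isLittleO_iff_tendsto' ?_).mpr ?_
    · filter_upwards [eventually_gt_atTop 0] with x hx h0 using absurd h0 hx.ne'
    · refine (tendsto_inv_atTop_zero.comp tendsto_sqrt_atTop).congr fun x ↦ ?_
      simp [sqrt_div_self']
  refine ((tendsto_psi_div_self.sub h).congr fun x ↦ ?_).trans (by simp)
  simp only [Pi.sub_apply]
  ring

theorem tendsto_primeCounting_mul_log_div_self :
    Tendsto (fun x : ℝ ↦ Nat.primeCounting ⌊x⌋₊ * log x / x) atTop (𝓝 1) := by
  have h : Tendsto (fun x : ℝ ↦ (Nat.primeCounting ⌊x⌋₊ - Chebyshev.theta x / log x) / (x / log x))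
      atTop (𝓝 0) := by
    refine Asymptotics.IsLittleO.tendsto_div_nhds_zero
      (Chebyshev.primeCounting_sub_theta_div_log_isBigO.trans_isLittleO ?_)
    refine (Asymptotics.isLittleO_iff_tendsto' ?_).mpr ?_
    · filter_upwards [eventually_gt_atTop 1] with x hx h0
      exact absurd h0 (div_pos (by linarith) (log_pos hx)).ne'
    · refine (tendsto_inv_atTop_zero.comp tendsto_log_atTop).congr' ?_
      filter_upwards [eventually_gt_atTop 1] with x hx
      have := (log_pos hx).ne'
      simp only [Function.comp_apply]
      field_simp
  refine ((h.add tendsto_theta_div_self).congr' ?_).trans (by simp)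
  filter_upwards [eventually_gt_atTop 1] with x hx
  have := (log_pos hx).ne'
  field_simp
  ring

lemma tendsto_log_log_atTop : Tendsto (fun n : ℕ ↦ log (log n)) atTop atTop :=
  tendsto_log_atTop.comp (tendsto_log_atTop.comp tendsto_natCast_atTop_atTop)

lemma log_log_succ_sub_bounds {n : ℕ} (hn : 2 ≤ n) :
    1 / ((n + 1) * log (n + 1)) ≤ log (log (n + 1)) - log (log n) ∧
      log (log (n + 1)) - log (log n) ≤ 1 / (n * log n) := by
  have h2 : (2 : ℝ) ≤ n := by exact_mod_cast hn
  have hl : 0 < log n := log_pos (by linarith)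
  have hl' : 0 < log (n + 1) := log_pos (by linarith)
  have key {a b : ℝ} (ha : 0 < a) (hb : 0 < b) : log b - log a ≤ (b - a) / a := by
    have h := log_le_sub_one_of_pos (div_pos hb ha)
    rw [log_div hb.ne' ha.ne'] at h
    rwa [sub_div, div_self ha.ne']
  have k1 := key hl hl'
  have k2 := key hl' hl
  have k3 := key (a := n) (b := n + 1) (by linarith) (by linarith)
  have k4 := key (a := n + 1) (b := n) (by linarith) (by linarith)
  rw [add_sub_cancel_left] at k3
  rw [sub_add_cancel_left] at k4
  constructor
  · rw [← div_div]
    have : 1 / (n + 1) / log (n + 1) ≤ (log (n + 1) - log n) / log (n + 1) := by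
      gcongr
      rw [neg_div] at k4
      linarith
    have e : (log n - log (n + 1)) / log (n + 1) = -((log (n + 1) - log n) / log (n + 1)) := by ring
    linarith
  · rw [← div_div]
    exact k1.trans (by gcongr)

lemma tendsto_log_div_log_succ : Tendsto (fun n : ℕ ↦ log n / log (n + 1)) atTop (𝓝 1) := by
  have hl : Tendsto (fun n : ℕ ↦ (log (n + 1 : ℝ))⁻¹) atTop (𝓝 0) :=
    tendsto_inv_atTop_zero.comp (tendsto_log_atTop.comp
      (tendsto_atTop_add_const_right _ 1 tendsto_natCast_atTop_atTop))
  have h := (tendsto_const_nhds (x := (1 : ℝ))).sub hl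
  rw [sub_zero] at h
  refine tendsto_of_tendsto_of_tendsto_of_le_of_le' h tendsto_const_nhds ?_ ?_
  · filter_upwards [eventually_ge_atTop 2] with n hn
    have h2 : (2 : ℝ) ≤ n := by exact_mod_cast hn
    have hl' : 0 < log ((n : ℝ) + 1) := log_pos (by linarith)
    have h := log_le_sub_one_of_pos (x := (n + 1) / n) (by positivity)
    rw [log_div (by positivity) (by positivity)] at h
    have h1 : ((n : ℝ) + 1) / n - 1 ≤ 1 := by
      rw [sub_le_iff_le_add, div_le_iff₀ (by linarith)]
      linarith
    rw [le_div_iff₀ hl', sub_mul, inv_mul_cancel₀ hl'.ne']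
    linarith
  · filter_upwards [eventually_ge_atTop 2] with n hn
    have h2 : (2 : ℝ) ≤ n := by exact_mod_cast hn
    exact div_le_one_of_le₀ (log_le_log (by linarith) (by linarith)) (log_nonneg (by linarith))

lemma tendsto_natCast_div_succ : Tendsto (fun n : ℕ ↦ (n : ℝ) / (n + 1)) atTop (𝓝 1) :=
  tendsto_natCast_div_add_atTop 1

lemma tendsto_mul_log_mul_log_log_succ_sub :
    Tendsto (fun n : ℕ ↦ n * log n * (log (log (n + 1)) - log (log n))) atTop (𝓝 1) := by
  have h := tendsto_natCast_div_succ.mul tendsto_log_div_log_succ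
  rw [one_mul] at h
  refine tendsto_of_tendsto_of_tendsto_of_le_of_le' h tendsto_const_nhds ?_ ?_
  all_goals
    filter_upwards [eventually_ge_atTop 2] with n hn
    have h2 : (2 : ℝ) ≤ n := by exact_mod_cast hn
    have hl : 0 < log n := log_pos (by linarith)
    have hb := log_log_succ_sub_bounds hn
  · calc _ = n * log n * (1 / ((n + 1) * log (n + 1))) := by rw [div_mul_div_comm]; ring
      _ ≤ _ := by gcongr; exact hb.1
  · calc _ ≤ n * log n * (1 / (n * log n)) := by gcongr; exact hb.2
      _ = 1 := by field_simp

lemma sum_one_div_primes_eq (N : ℕ) :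
    ∑ p ∈ Finset.Icc 1 (N + 2) with p.Prime, (1 : ℝ) / p =
      ∑ i ∈ Finset.range N, Nat.primeCounting (i + 2) / (((i + 2 : ℕ) : ℝ) * ((i + 2 : ℕ) + 1)) +
        Nat.primeCounting (N + 2) / ((N + 2 : ℕ) : ℝ) := by
  induction N with
  | zero =>
    have : (Finset.Icc 1 (0 + 2)).filter Nat.Prime = {2} := by decide
    have h2 : Nat.primeCounting 2 = 1 := by decide
    simp [this, h2]
  | succ N ih =>
    have hπ : (Nat.primeCounting (N + 3) : ℝ) =
        Nat.primeCounting (N + 2) + if (N + 3).Prime then 1 else 0 := by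
      have : Nat.primeCounting (N + 3) =
          Nat.primeCounting (N + 2) + if (N + 3).Prime then 1 else 0 := by
        rw [Nat.primeCounting, Nat.primeCounting, Nat.primeCounting', Nat.count_succ]
      rw [this]; push_cast; rfl
    rw [Finset.sum_filter] at ih ⊢
    rw [show N + 1 + 2 = N + 2 + 1 by ring, Finset.sum_Icc_succ_top (by omega), ih,
      Finset.sum_range_succ, show N + 2 + 1 = N + 3 by ring, hπ]
    push_cast
    split_ifs <;> field_simp <;> ring

/-- **Mertens' second theorem** in asymptotic form. -/
theorem tendsto_sum_one_div_primes_div_log_log :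
    Tendsto (fun N : ℕ ↦ (∑ p ∈ Finset.Icc 1 N with p.Prime, (1 : ℝ) / p) / log (log N))
      atTop (𝓝 1) := by
  set a : ℕ → ℝ := fun n ↦ Nat.primeCounting n / ((n : ℝ) * (n + 1)) with ha
  set v : ℕ → ℝ := fun n ↦ log (log ((n + 1 : ℕ) : ℝ)) - log (log n) with hv
  have hvpos (n : ℕ) (hn : 2 ≤ n) : 0 < v n := by
    have h := (log_log_succ_sub_bounds hn).1
    have h2 : (2 : ℝ) ≤ n := by exact_mod_cast hn
    have hl' : 0 < log ((n : ℝ) + 1) := log_pos (by linarith)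
    simp only [hv]
    push_cast
    exact lt_of_lt_of_le (by positivity) h
  have hav : Tendsto (fun n ↦ a n / v n) atTop (𝓝 1) := by
    have h1 := (tendsto_primeCounting_mul_log_div_self.comp tendsto_natCast_atTop_atTop).mul
      tendsto_natCast_div_succ
    have h2 := h1.div tendsto_mul_log_mul_log_log_succ_sub one_ne_zero
    rw [one_mul, div_one] at h2
    refine h2.congr' ?_
    filter_upwards [eventually_ge_atTop 2] with n hn
    have := (hvpos n hn).ne'
    have h2 : (2 : ℝ) ≤ n := by exact_mod_cast hn
    have hl : log n ≠ 0 := (log_pos (by linarith)).ne'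
    simp only [hv, Nat.cast_add, Nat.cast_one] at this
    simp only [ha, hv, Pi.div_apply, Function.comp_apply, Nat.floor_natCast, Nat.cast_add,
      Nat.cast_one]
    field_simp
  have hsum (N : ℕ) : ∑ i ∈ Finset.range N, v (i + 2) = log (log ((N + 2 : ℕ) : ℝ)) -
      log (log (2 : ℕ)) := by
    have := Finset.sum_range_sub (fun i ↦ log (log ((i + 2 : ℕ) : ℝ))) N
    simpa [hv, add_right_comm] using this
  have hlim : Tendsto (fun N : ℕ ↦ log (log ((N + 2 : ℕ) : ℝ))) atTop atTop :=
    tendsto_log_log_atTop.comp (tendsto_add_atTop_nat 2)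
  have hdiff : (fun n ↦ a (n + 2) - v (n + 2)) =o[atTop] fun n ↦ v (n + 2) := by
    refine Asymptotics.isLittleO_of_tendsto (fun n h ↦ absurd h (hvpos _ (by omega)).ne') ?_
    have := (hav.comp (tendsto_add_atTop_nat 2)).sub_const 1
    rw [sub_self] at this
    refine this.congr fun n ↦ ?_
    rw [sub_div, div_self (hvpos (n + 2) (by omega)).ne']
    rfl
  have hs := hdiff.sum_range (fun n ↦ (hvpos _ (by omega)).le)
    (by simp_rw [hsum]; exact tendsto_atTop_add_const_right _ _ hlim)
  simp_rw [hsum, Finset.sum_sub_distrib, hsum] at hs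
  have hc (c : ℝ) : Tendsto (fun N : ℕ ↦ c / log (log ((N + 2 : ℕ) : ℝ))) atTop (𝓝 0) :=
    hlim.const_div_atTop c
  have hO : (fun N : ℕ ↦ log (log ((N + 2 : ℕ) : ℝ)) - log (log (2 : ℕ))) =O[atTop]
      fun N : ℕ ↦ log (log ((N + 2 : ℕ) : ℝ)) :=
    (Asymptotics.isBigO_refl _ _).sub
      ((Asymptotics.isLittleO_const_left.mpr (.inr (tendsto_norm_atTop_atTop.comp hlim))).isBigO)
  have hs' := (hs.trans_isBigO hO).tendsto_div_nhds_zero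
  have hπ : Tendsto (fun N : ℕ ↦ (Nat.primeCounting (N + 2) / ((N + 2 : ℕ) : ℝ)) /
      log (log ((N + 2 : ℕ) : ℝ))) atTop (𝓝 0) := by
    refine tendsto_of_tendsto_of_tendsto_of_le_of_le' tendsto_const_nhds (hc 2) ?_ ?_
    all_goals filter_upwards [hlim.eventually_gt_atTop 0] with N hN
    · positivity
    · gcongr
      rw [div_le_iff₀ (by positivity)]
      have : Nat.primeCounting (N + 2) ≤ 2 * (N + 2) :=
        (Nat.count_le (p := Nat.Prime)).trans (by omega)
      exact_mod_cast this
  rw [← tendsto_add_atTop_iff_nat 2]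
  have := ((hs'.add hπ).sub (hc (log (log (2 : ℕ))))).add_const 1
  refine (this.congr' ?_).trans (by simp)
  filter_upwards [hlim.eventually_gt_atTop 0] with N hN
  rw [sum_one_div_primes_eq]
  field_simp
  simp only [ha]
  ring

/-- The integers `1 ≤ i ≤ N` with exactly `k` distinct prime factors. -/
def kPrimeFactors (k N : ℕ) : Finset ℕ := {i ∈ Finset.Icc 1 N | i.primeFactors.card = k}

/-- The prime powers `q ≤ y` coprime to `m`. -/
def coprimePrimePows (m y : ℕ) : Finset ℕ :=
  {q ∈ Finset.Icc 1 y | IsPrimePow q ∧ q.Coprime m}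

lemma mem_kPrimeFactors {k N i : ℕ} :
    i ∈ kPrimeFactors k N ↔ (1 ≤ i ∧ i ≤ N) ∧ i.primeFactors.card = k := by
  simp [kPrimeFactors]

lemma mem_coprimePrimePows {m y q : ℕ} :
    q ∈ coprimePrimePows m y ↔ (1 ≤ q ∧ q ≤ y) ∧ IsPrimePow q ∧ q.Coprime m := by
  simp [coprimePrimePows]

lemma card_primeFactors_mul_of_coprime {a b : ℕ} (h : a.Coprime b) :
    (a * b).primeFactors.card = a.primeFactors.card + b.primeFactors.card := by
  rw [h.primeFactors_mul, Finset.card_union_of_disjoint h.disjoint_primeFactors]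

lemma sum_sum_ordProj (F : ℕ → ℕ → ℝ) (k N : ℕ) :
    ∑ n ∈ kPrimeFactors (k + 1) N, ∑ p ∈ n.primeFactors, F (ordCompl[p] n) (ordProj[p] n) =
      ∑ m ∈ kPrimeFactors k N, ∑ q ∈ coprimePrimePows m (N / m), F m q := by
  rw [Finset.sum_sigma', Finset.sum_sigma']
  refine Finset.sum_bij (fun x _ ↦ ⟨ordCompl[x.2] x.1, ordProj[x.2] x.1⟩) ?_ ?_ ?_ ?_
  · rintro ⟨n, p⟩ hx
    simp only [Finset.mem_sigma, mem_kPrimeFactors, mem_coprimePrimePows] at hx ⊢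
    obtain ⟨⟨⟨hn1, hnN⟩, hcard⟩, hp⟩ := hx
    have hpp := Nat.prime_of_mem_primeFactors hp
    have hn0 : n ≠ 0 := by omega
    have hv : n.factorization p ≠ 0 :=
      (hpp.factorization_pos_of_dvd hn0 (Nat.dvd_of_mem_primeFactors hp)).ne'
    have hm0 := Nat.ordCompl_pos p hn0
    have hmul := Nat.ordProj_mul_ordCompl_eq_self n p
    have hcop := (Nat.coprime_ordCompl hpp hn0).pow_left (n.factorization p)
    refine ⟨⟨⟨hm0, (Nat.ordCompl_le n p).trans hnN⟩, ?_⟩,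
      ⟨Nat.pow_pos hpp.pos, ?_⟩, hpp.isPrimePow.pow hv, hcop⟩
    · have h := card_primeFactors_mul_of_coprime hcop
      rw [hmul, hcard, Nat.primeFactors_prime_pow hv hpp, Finset.card_singleton] at h
      omega
    · rw [Nat.le_div_iff_mul_le hm0, hmul]
      exact hnN
  · rintro ⟨n, p⟩ hx ⟨n', p'⟩ hx' h
    simp only [Finset.mem_sigma, mem_kPrimeFactors] at hx hx'
    simp only [Sigma.mk.injEq, heq_eq_eq] at h
    have hnn : n = n' := by
      rw [← Nat.ordProj_mul_ordCompl_eq_self n p, ← Nat.ordProj_mul_ordCompl_eq_self n' p', h.1,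
        h.2]
    have hmf {n p : ℕ} (hn : 1 ≤ n) (hp : p ∈ n.primeFactors) : (ordProj[p] n).minFac = p :=
      (Nat.prime_of_mem_primeFactors hp).pow_minFac
        ((Nat.prime_of_mem_primeFactors hp).factorization_pos_of_dvd (by omega)
          (Nat.dvd_of_mem_primeFactors hp)).ne'
    have hpp : p = p' := by
      rw [← hmf hx.1.1.1 hx.2, ← hmf hx'.1.1.1 hx'.2, h.2]
    rw [hnn, hpp]
  · rintro ⟨m, q⟩ hx
    simp only [Finset.mem_sigma, mem_kPrimeFactors, mem_coprimePrimePows] at hx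
    obtain ⟨⟨⟨hm1, hmN⟩, hcard⟩, ⟨hq1, hqN⟩, hq, hcop⟩ := hx
    obtain ⟨p, v, hp, hv, rfl⟩ := (isPrimePow_nat_iff q).mp hq
    have hpm : ¬p ∣ m := (hp.coprime_iff_not_dvd).mp ((Nat.coprime_pow_left_iff hv _ _).mp hcop)
    have hfac : (p ^ v * m).factorization p = v := by
      rw [Nat.factorization_mul (by positivity) (by omega), Finsupp.add_apply,
        hp.factorization_pow, Finsupp.single_eq_same, Nat.factorization_eq_zero_of_not_dvd hpm,
        add_zero]
    refine ⟨⟨p ^ v * m, p⟩, ?_, ?_⟩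
    · simp only [Finset.mem_sigma, mem_kPrimeFactors]
      refine ⟨⟨⟨Nat.mul_pos (Nat.pow_pos hp.pos) hm1, (Nat.le_div_iff_mul_le hm1).mp hqN⟩, ?_⟩, ?_⟩
      · rw [card_primeFactors_mul_of_coprime hcop, Nat.primeFactors_prime_pow hv.ne' hp, hcard,
          Finset.card_singleton, add_comm]
      · rw [Nat.mem_primeFactors]
        exact ⟨hp, (dvd_pow_self p hv.ne').mul_right m, by positivity⟩
    · simp only [hfac]
      rw [Nat.mul_div_cancel_left m (by positivity)]
  · rintro ⟨n, p⟩ _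
    rfl

lemma succ_mul_sum_one_div (k N : ℕ) :
    (k + 1) * ∑ n ∈ kPrimeFactors (k + 1) N, (1 : ℝ) / n =
      ∑ m ∈ kPrimeFactors k N, (1 : ℝ) / m * ∑ q ∈ coprimePrimePows m (N / m), (1 : ℝ) / q := by
  simp_rw [Finset.mul_sum]
  rw [← sum_sum_ordProj fun m q ↦ (1 : ℝ) / m * (1 / q)]
  refine Finset.sum_congr rfl fun n hn ↦ ?_
  have hcard := (mem_kPrimeFactors.mp hn).2
  rw [Finset.sum_congr rfl (g := fun _ ↦ (1 : ℝ) / n) fun p _ ↦ ?_, Finset.sum_const, hcard]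
  · simp
  · rw [div_mul_div_comm, one_mul, ← Nat.cast_mul, mul_comm, Nat.ordProj_mul_ordCompl_eq_self]

lemma sum_log_eq (k N : ℕ) :
    ∑ n ∈ kPrimeFactors (k + 1) N, log n =
      ∑ m ∈ kPrimeFactors k N, ∑ q ∈ coprimePrimePows m (N / m), log q := by
  rw [← sum_sum_ordProj fun _ q ↦ log q]
  refine Finset.sum_congr rfl fun n hn ↦ ?_
  have hn0 : n ≠ 0 := by have := mem_kPrimeFactors.mp hn; omega
  rw [← log_prod (fun p hp ↦ by
    have := (Nat.prime_of_mem_primeFactors hp).pos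
    positivity), ← Nat.cast_prod]
  congr 2
  exact (Nat.prod_factorization_pow_eq_self hn0).symm

lemma log_two_le_vonMangoldt {q : ℕ} (hq : IsPrimePow q) :
    log 2 ≤ ArithmeticFunction.vonMangoldt q := by
  rw [ArithmeticFunction.vonMangoldt_apply, if_pos hq]
  exact log_le_log two_pos (by exact_mod_cast (Nat.minFac_prime hq.ne_one).two_le)

lemma exists_sum_one_div_primePow_le : ∃ C, ∀ N : ℕ,
    ∑ q ∈ Finset.Icc 1 N with IsPrimePow q, (1 : ℝ) / q ≤
      ∑ p ∈ Finset.Icc 1 N with p.Prime, (1 : ℝ) / p + C := by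
  have hs := ArithmeticFunction.vonMangoldt.summable_residueClass_non_primes_div (1 : ZMod 1)
  refine ⟨(∑' n : ℕ, (if n.Prime then 0
    else ArithmeticFunction.vonMangoldt.residueClass (1 : ZMod 1) n) / n) / log 2, fun N ↦ ?_⟩
  have hnn (n : ℕ) : 0 ≤ (if n.Prime then 0
      else ArithmeticFunction.vonMangoldt.residueClass (1 : ZMod 1) n) / n := by
    have := ArithmeticFunction.vonMangoldt.residueClass_nonneg (1 : ZMod 1) n
    positivity
  have hl : 0 < log 2 := log_pos one_lt_two
  have h := div_le_div_of_nonneg_right (hs.sum_le_tsum (Finset.Icc 1 N) fun n _ ↦ hnn n) hl.le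
  refine le_trans ?_ (add_le_add_right h _)
  rw [Finset.sum_filter, Finset.sum_filter, Finset.sum_div, ← Finset.sum_add_distrib]
  refine Finset.sum_le_sum fun q _ ↦ ?_
  by_cases hp : q.Prime
  · simp [hp, hp.isPrimePow]
  · by_cases hq : IsPrimePow q
    · have hres : ArithmeticFunction.vonMangoldt.residueClass (1 : ZMod 1) q =
          ArithmeticFunction.vonMangoldt q :=
        indicator_of_mem (show q ∈ {n : ℕ | (n : ZMod 1) = 1} from Subsingleton.elim _ _) _
      rw [if_pos hq, if_neg hp, if_neg hp, zero_add, hres, div_right_comm]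
      gcongr
      rw [le_div_iff₀ hl, one_mul]
      exact log_two_le_vonMangoldt hq
    · have := hnn q
      rw [if_neg hq, if_neg hp]
      positivity

lemma tendsto_sum_one_div_primePow_div_log_log :
    Tendsto (fun N : ℕ ↦ (∑ q ∈ Finset.Icc 1 N with IsPrimePow q, (1 : ℝ) / q) / log (log N))
      atTop (𝓝 1) := by
  obtain ⟨C, hC⟩ := exists_sum_one_div_primePow_le
  have h := tendsto_sum_one_div_primes_div_log_log
  have h' := h.add (tendsto_log_log_atTop.const_div_atTop C)
  rw [add_zero] at h'
  refine tendsto_of_tendsto_of_tendsto_of_le_of_le' h h' ?_ ?_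
  all_goals filter_upwards [tendsto_log_log_atTop.eventually_gt_atTop 0] with N hN
  · gcongr
    exact fun hp ↦ hp.isPrimePow
  · rw [← add_div]
    gcongr
    exact hC N

lemma tendsto_sqrt_atTop_nat : Tendsto Nat.sqrt atTop atTop :=
  tendsto_atTop.mpr fun b ↦ by
    filter_upwards [eventually_ge_atTop (b * b)] with n hn using Nat.le_sqrt.mpr hn

lemma tendsto_log_log_natSqrt_div :
    Tendsto (fun N : ℕ ↦ log (log N.sqrt) / log (log N)) atTop (𝓝 1) := by
  have h := (tendsto_const_nhds (x := (1 : ℝ))).sub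
    (tendsto_log_log_atTop.const_div_atTop (log 4))
  rw [sub_zero] at h
  refine tendsto_of_tendsto_of_tendsto_of_le_of_le' h tendsto_const_nhds ?_ ?_
  all_goals
    filter_upwards [tendsto_log_log_atTop.eventually_gt_atTop 0,
      tendsto_sqrt_atTop_nat.eventually_ge_atTop 2] with N hN hs
    have hs' : (2 : ℝ) ≤ N.sqrt := by exact_mod_cast hs
    have hls : 0 < log N.sqrt := log_pos (by linarith)
  · have hlt : (N : ℝ) ≤ (N.sqrt : ℝ) ^ 4 := by
      have h : N ≤ N.sqrt ^ 4 := calc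
        N ≤ (N.sqrt + 1) ^ 2 := (Nat.lt_succ_sqrt' N).le
        _ ≤ (N.sqrt ^ 2) ^ 2 := by gcongr; nlinarith
        _ = N.sqrt ^ 4 := by ring
      exact_mod_cast h
    have hN0 : 0 < (N : ℝ) := by
      have := Nat.sqrt_le_self N
      exact_mod_cast (by omega : 0 < N)
    have h4 : log N ≤ 4 * log N.sqrt := by
      have := log_le_log hN0 hlt
      rwa [log_pow] at this
    have hlN : 0 < log N := by
      have : (2 : ℝ) ≤ N := hs'.trans (by exact_mod_cast Nat.sqrt_le_self N)
      exact log_pos (by linarith)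
    have h5 := log_le_log hlN h4
    rw [log_mul (by norm_num) hls.ne'] at h5
    rw [le_div_iff₀ hN, sub_mul, div_mul_cancel₀ _ hN.ne']
    linarith
  · refine div_le_one_of_le₀ ?_ hN.le
    gcongr
    exact Nat.sqrt_le_self N

lemma kPrimeFactors_mono (k : ℕ) : Monotone (kPrimeFactors k) := fun _ _ h _ hi ↦ by
  rw [mem_kPrimeFactors] at hi ⊢
  exact ⟨⟨hi.1.1, hi.1.2.trans h⟩, hi.2⟩

lemma le_div_of_le_sqrt {m N : ℕ} (hm : 1 ≤ m) (h : m ≤ N.sqrt) : N.sqrt ≤ N / m := by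
  rw [Nat.le_div_iff_mul_le hm]
  exact (Nat.mul_le_mul_left _ h).trans (Nat.sqrt_le N)

lemma succ_mul_sum_one_div_le (k N : ℕ) :
    (k + 1) * ∑ n ∈ kPrimeFactors (k + 1) N, (1 : ℝ) / n ≤
      (∑ m ∈ kPrimeFactors k N, (1 : ℝ) / m) *
        ∑ q ∈ Finset.Icc 1 N with IsPrimePow q, (1 : ℝ) / q := by
  rw [succ_mul_sum_one_div, Finset.sum_mul]
  gcongr with m hm
  intro q hq
  rw [mem_coprimePrimePows] at hq
  rw [Finset.mem_filter, Finset.mem_Icc]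
  exact ⟨⟨hq.1.1, hq.1.2.trans (Nat.div_le_self _ _)⟩, hq.2.1⟩

lemma sum_primes_le_sum_coprimePrimePows {f : ℕ → ℝ} (hf : ∀ q, 0 ≤ f q) {c : ℝ} {m y : ℕ}
    (hm : m ≠ 0) (hc : ∀ p ∈ m.primeFactors, p ≤ y → f p ≤ c) (hc0 : 0 ≤ c) :
    ∑ p ∈ Finset.Icc 1 y with p.Prime, f p ≤
      ∑ q ∈ coprimePrimePows m y, f q + m.primeFactors.card * c := by
  rw [← Finset.sum_filter_add_sum_filter_not _ (fun p ↦ p ∣ m) f, add_comm]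
  refine add_le_add (Finset.sum_le_sum_of_subset_of_nonneg ?_ fun q _ _ ↦ hf q) ?_
  · intro p hp
    simp only [Finset.mem_filter, Finset.mem_Icc] at hp
    exact mem_coprimePrimePows.mpr ⟨hp.1.1, hp.1.2.isPrimePow,
      hp.1.2.coprime_iff_not_dvd.mpr hp.2⟩
  · refine (Finset.sum_le_card_nsmul _ _ c fun p hp ↦ ?_).trans ?_
    · simp only [Finset.mem_filter, Finset.mem_Icc] at hp
      exact hc p (Nat.mem_primeFactors.mpr ⟨hp.1.2, hp.2, hm⟩) hp.1.1.2
    · rw [nsmul_eq_mul]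
      gcongr
      intro p hp
      simp only [Finset.mem_filter, Finset.mem_Icc] at hp
      exact Nat.mem_primeFactors.mpr ⟨hp.1.2, hp.2, hm⟩

lemma le_succ_mul_sum_one_div (k N : ℕ) :
    (∑ m ∈ kPrimeFactors k N.sqrt, (1 : ℝ) / m) *
        (∑ p ∈ Finset.Icc 1 N.sqrt with p.Prime, (1 : ℝ) / p - k) ≤
      (k + 1) * ∑ n ∈ kPrimeFactors (k + 1) N, (1 : ℝ) / n := by
  rw [succ_mul_sum_one_div, Finset.sum_mul]
  refine le_trans (Finset.sum_le_sum fun m hm ↦ ?_) (Finset.sum_le_sum_of_subset_of_nonneg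
    (kPrimeFactors_mono k (Nat.sqrt_le_self N)) fun m _ _ ↦ by positivity)
  obtain ⟨⟨hm1, hmN⟩, hcard⟩ := mem_kPrimeFactors.mp hm
  gcongr
  have h := sum_primes_le_sum_coprimePrimePows (f := fun q ↦ (1 : ℝ) / q) (c := 1)
    (y := N.sqrt) (fun q ↦ by positivity) (show m ≠ 0 by omega)
    (fun p hp _ ↦ by
      have := (Nat.prime_of_mem_primeFactors hp).one_lt.le
      exact div_le_one_of_le₀ (by exact_mod_cast this) (by positivity)) zero_le_one
  rw [hcard, mul_one] at h
  have h2 : ∑ q ∈ coprimePrimePows m N.sqrt, (1 : ℝ) / q ≤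
      ∑ q ∈ coprimePrimePows m (N / m), (1 : ℝ) / q := by
    gcongr
    intro q hq
    rw [mem_coprimePrimePows] at hq ⊢
    exact ⟨⟨hq.1.1, hq.1.2.trans (le_div_of_le_sqrt hm1 hmN)⟩, hq.2⟩
  linarith

lemma kPrimeFactors_zero {N : ℕ} (hN : 1 ≤ N) : kPrimeFactors 0 N = {1} := by
  ext i
  rw [mem_kPrimeFactors, Finset.card_eq_zero, Nat.primeFactors_eq_empty, Finset.mem_singleton]
  omega

theorem tendsto_sum_one_div_kPrimeFactors (k : ℕ) :
    Tendsto (fun N : ℕ ↦ (∑ m ∈ kPrimeFactors k N, (1 : ℝ) / m) / log (log N) ^ k) atTop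
      (𝓝 (1 / k.factorial)) := by
  induction k with
  | zero =>
    refine tendsto_const_nhds.congr' ?_
    filter_upwards [eventually_ge_atTop 1] with N hN
    simp [kPrimeFactors_zero hN]
  | succ k ih =>
    have hup := ih.mul tendsto_sum_one_div_primePow_div_log_log
    have hlow := ((ih.comp tendsto_sqrt_atTop_nat).mul
      ((tendsto_sum_one_div_primes_div_log_log.sub
        (tendsto_log_log_atTop.const_div_atTop (k : ℝ))).comp tendsto_sqrt_atTop_nat)).mul
      (tendsto_log_log_natSqrt_div.pow (k + 1))
    simp only [sub_zero, mul_one, one_pow] at hup hlow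
    have h : Tendsto (fun N : ℕ ↦ (k + 1) * ((∑ m ∈ kPrimeFactors (k + 1) N, (1 : ℝ) / m) /
        log (log N) ^ (k + 1))) atTop (𝓝 (1 / k.factorial)) := by
      refine tendsto_of_tendsto_of_tendsto_of_le_of_le' hlow hup ?_ ?_
      · filter_upwards [tendsto_log_log_atTop.eventually_gt_atTop 0,
          (tendsto_log_log_atTop.comp tendsto_sqrt_atTop_nat).eventually_gt_atTop 0] with N hN hs
        simp only [Function.comp_apply] at hs ⊢
        rw [← mul_div_assoc]
        refine le_trans (le_of_eq ?_) (div_le_div_of_nonneg_right (le_succ_mul_sum_one_div k N)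
          (by positivity))
        rw [div_pow, pow_succ (log (log N.sqrt))]
        field_simp
      · filter_upwards [tendsto_log_log_atTop.eventually_gt_atTop 0] with N hN
        rw [← mul_div_assoc, div_mul_div_comm, ← pow_succ]
        exact div_le_div_of_nonneg_right (succ_mul_sum_one_div_le k N) (by positivity)
    have hk : (k : ℝ) + 1 ≠ 0 := by positivity
    have h2 := h.const_mul ((k : ℝ) + 1)⁻¹
    simp_rw [inv_mul_cancel_left₀ hk] at h2
    convert h2 using 2
    rw [Nat.factorial_succ]
    push_cast
    field_simp

/-- An error term for the sum of `log q` over prime powers `q ≤ x` coprime to an integer with `k`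
prime factors. -/
noncomputable def thetaError (k : ℕ) (x : ℝ) : ℝ :=
  |Chebyshev.theta x - x| + k * log x + (Chebyshev.psi x - Chebyshev.theta x) * log x / log 2

lemma abs_sum_log_sub_le {x : ℝ} (hx : 1 ≤ x) {m : ℕ} (hm : m ≠ 0) :
    |∑ q ∈ coprimePrimePows m ⌊x⌋₊, log q - x| ≤ thetaError m.primeFactors.card x := by
  have hl : 0 ≤ log x := log_nonneg hx
  have hlogx {q : ℕ} (h1 : 1 ≤ q) (h : q ≤ ⌊x⌋₊) : log q ≤ log x :=
    log_le_log (by exact_mod_cast h1) ((Nat.le_floor_iff (by linarith)).mp h)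
  have hl2 : 0 < log 2 := log_pos one_lt_two
  have htheta : Chebyshev.theta x = ∑ p ∈ Finset.Icc 1 ⌊x⌋₊ with p.Prime, log p := rfl
  have hlow := sum_primes_le_sum_coprimePrimePows (f := fun q ↦ log q) (c := log x)
    (y := ⌊x⌋₊) (fun q ↦ log_natCast_nonneg q) hm
    (fun p hp h ↦ hlogx (Nat.prime_of_mem_primeFactors hp).one_lt.le h) hl
  have hup : ∑ q ∈ coprimePrimePows m ⌊x⌋₊, log q ≤ Chebyshev.theta x +
      (Chebyshev.psi x - Chebyshev.theta x) * log x / log 2 := by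
    rw [Chebyshev.psi_sub_theta_eq_sum_not_prime, htheta, Finset.sum_mul, Finset.sum_div,
      ← Finset.sum_filter_add_sum_filter_not (coprimePrimePows m ⌊x⌋₊) Nat.Prime]
    refine add_le_add (Finset.sum_le_sum_of_subset_of_nonneg ?_ fun q _ _ ↦ log_natCast_nonneg q)
      ((Finset.sum_le_sum fun q hq ↦ ?_).trans (Finset.sum_le_sum_of_subset_of_nonneg
        (f := fun q ↦ ArithmeticFunction.vonMangoldt q * log x / log 2) ?_ fun q _ _ ↦ ?_))
    · intro q hq
      rw [Finset.mem_filter, mem_coprimePrimePows] at hq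
      rw [Finset.mem_filter, Finset.mem_Icc]
      exact ⟨hq.1.1, hq.2⟩
    · rw [Finset.mem_filter, mem_coprimePrimePows] at hq
      rw [le_div_iff₀ hl2, mul_comm]
      exact mul_le_mul (log_two_le_vonMangoldt hq.1.2.1) (hlogx hq.1.1.1 hq.1.1.2)
        (log_natCast_nonneg q) ArithmeticFunction.vonMangoldt_nonneg
    · intro q hq
      rw [Finset.mem_filter, mem_coprimePrimePows] at hq
      rw [Finset.mem_filter, Finset.mem_Ioc]
      exact ⟨hq.1.1, hq.2⟩
    · have := ArithmeticFunction.vonMangoldt_nonneg (n := q)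
      positivity
  have h1 := le_abs_self (Chebyshev.theta x - x)
  have h2 := neg_abs_le (Chebyshev.theta x - x)
  have h3 : 0 ≤ (m.primeFactors.card : ℝ) * log x := by positivity
  have h4 : 0 ≤ (Chebyshev.psi x - Chebyshev.theta x) * log x / log 2 := by
    have := sub_nonneg.mpr (Chebyshev.theta_le_psi x)
    positivity
  rw [← htheta] at hlow
  rw [thetaError, abs_le]
  constructor <;> linarith

lemma tendsto_thetaError_div (k : ℕ) : Tendsto (fun x ↦ thetaError k x / x) atTop (𝓝 0) := by
  have h1 : Tendsto (fun x ↦ |Chebyshev.theta x / x - 1|) atTop (𝓝 0) := by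
    simpa using (tendsto_theta_div_self.sub_const 1).abs
  have h2 : Tendsto (fun x ↦ (k : ℝ) * (log x / x)) atTop (𝓝 0) := by
    simpa using isLittleO_log_id_atTop.tendsto_div_nhds_zero.const_mul (k : ℝ)
  have h3 : Tendsto (fun x ↦ ((Chebyshev.psi - Chebyshev.theta) x * log x) / (√x * √x)) atTop
      (𝓝 0) := by
    refine Asymptotics.IsLittleO.tendsto_div_nhds_zero
      (Chebyshev.isBigO_psi_sub_theta_sqrt.mul_isLittleO ?_)
    simpa only [← sqrt_eq_rpow] using isLittleO_log_rpow_atTop (r := 1 / 2) (by norm_num)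
  have h := (h1.add h2).add (h3.div_const (log 2))
  simp only [zero_div, add_zero] at h
  refine h.congr' ?_
  filter_upwards [eventually_gt_atTop 0] with x hx
  have e : |Chebyshev.theta x / x - 1| = |Chebyshev.theta x - x| / x := by
    rw [← abs_of_pos hx, ← abs_div, abs_of_pos hx, sub_div, div_self hx.ne']
  rw [e, mul_self_sqrt hx.le, thetaError, Pi.sub_apply]
  ring

lemma exists_thetaError_le (k : ℕ) : ∃ C, 0 ≤ C ∧ ∀ x, 1 ≤ x → thetaError k x ≤ C * x := by
  obtain ⟨C, hC⟩ := Chebyshev.psi_sub_theta_le_mul_sqrt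
  have hl2 : 0 < log 2 := log_pos one_lt_two
  have hl4 : 0 < log 4 := log_pos (by norm_num)
  refine ⟨log 4 + 1 + k + |C| * 2 / log 2, by positivity, fun x hx ↦ ?_⟩
  have hl : 0 ≤ log x := log_nonneg hx
  have h1 : |Chebyshev.theta x - x| ≤ (log 4 + 1) * x := by
    have := Chebyshev.theta_le_log4_mul_x (x := x) (by linarith)
    have := Chebyshev.theta_nonneg x
    rw [abs_le]
    constructor <;> nlinarith
  have h2 : (k : ℝ) * log x ≤ k * x := by
    gcongr
    linarith [log_le_sub_one_of_pos (show 0 < x by linarith)]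
  have h3 : log x ≤ 2 * √x := by
    have := log_le_sub_one_of_pos (sqrt_pos.mpr (show 0 < x by linarith))
    rw [log_sqrt (by linarith)] at this
    linarith
  have h4 : (Chebyshev.psi x - Chebyshev.theta x) * log x ≤ |C| * 2 * x := calc
    _ ≤ (|C| * √x) * (2 * √x) := by
      gcongr
      exact (hC x).trans (by gcongr; exact le_abs_self C)
    _ = |C| * 2 * (√x * √x) := by ring
    _ = _ := by rw [mul_self_sqrt (by linarith)]
  have h5 := div_le_div_of_nonneg_right h4 hl2.le
  rw [thetaError]
  calc _ ≤ (log 4 + 1) * x + k * x + |C| * 2 * x / log 2 := by gcongr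
    _ = _ := by ring

lemma abs_sum_log_sub_mul_le (k N : ℕ) :
    |∑ n ∈ kPrimeFactors (k + 1) N, log n - N * ∑ m ∈ kPrimeFactors k N, (1 : ℝ) / m| ≤
      ∑ m ∈ kPrimeFactors k N, thetaError k (N / m) := by
  rw [sum_log_eq, Finset.mul_sum, ← Finset.sum_sub_distrib]
  refine (Finset.abs_sum_le_sum_abs _ _).trans (Finset.sum_le_sum fun m hm ↦ ?_)
  obtain ⟨⟨hm1, hmN⟩, hcard⟩ := mem_kPrimeFactors.mp hm
  have hm0 : (0 : ℝ) < m := by exact_mod_cast hm1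
  have h1 : (1 : ℝ) ≤ N / m := by
    rw [one_le_div hm0]
    exact_mod_cast hmN
  have h := abs_sum_log_sub_le h1 (show m ≠ 0 by omega)
  rw [hcard, Nat.floor_div_eq_div] at h
  rwa [mul_one_div]

lemma tendsto_sum_thetaError (k : ℕ) :
    Tendsto (fun N : ℕ ↦ (∑ m ∈ kPrimeFactors k N, thetaError k (N / m)) /
      (N * log (log N) ^ k)) atTop (𝓝 0) := by
  obtain ⟨C, hC0, hC⟩ := exists_thetaError_le k
  have hS := tendsto_sum_one_div_kPrimeFactors k
  have hS' := (hS.comp tendsto_sqrt_atTop_nat).mul (tendsto_log_log_natSqrt_div.pow k)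
  rw [one_pow, mul_one] at hS'
  have hpos {x : ℝ} (hx : 1 ≤ x) : 0 ≤ thetaError k x := by
    have := sub_nonneg.mpr (Chebyshev.theta_le_psi x)
    have := log_nonneg hx
    rw [thetaError]
    positivity
  rw [tendsto_order]
  constructor
  · intro a ha
    filter_upwards [tendsto_log_log_atTop.eventually_gt_atTop 0] with N hN
    refine ha.trans_le (div_nonneg (Finset.sum_nonneg fun m hm ↦ hpos ?_) (by positivity))
    obtain ⟨⟨hm1, hmN⟩, -⟩ := mem_kPrimeFactors.mp hm
    rw [one_le_div (by exact_mod_cast hm1)]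
    exact_mod_cast hmN
  · intro ε hε
    have hlim := (hS.const_mul (ε / 2)).add ((hS.sub hS').const_mul C)
    have hlt : ε / 2 * (1 / (k.factorial : ℝ)) +
        C * (1 / (k.factorial : ℝ) - 1 / (k.factorial : ℝ)) < ε := by
      have : 1 / (k.factorial : ℝ) ≤ 1 :=
        div_le_one_of_le₀ (by exact_mod_cast k.factorial_pos) (by positivity)
      nlinarith
    have hE := (tendsto_thetaError_div k).eventually_lt_const (half_pos hε)
    obtain ⟨X, hX⟩ := eventually_atTop.mp (hE.and (eventually_gt_atTop 0))
    filter_upwards [hlim.eventually_lt_const hlt, tendsto_log_log_atTop.eventually_gt_atTop 0,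
      (tendsto_log_log_atTop.comp tendsto_sqrt_atTop_nat).eventually_gt_atTop 0,
      (tendsto_natCast_atTop_atTop.comp tendsto_sqrt_atTop_nat).eventually_ge_atTop X,
      eventually_gt_atTop 0] with N hN hL hLs hs hN0
    refine lt_of_le_of_lt ?_ hN
    have hN0' : (0 : ℝ) < N := by exact_mod_cast hN0
    have hsub := kPrimeFactors_mono k (Nat.sqrt_le_self N)
    have hsdiff := Finset.sum_sdiff hsub (f := fun m : ℕ ↦ (1 : ℝ) / m)
    have hsmall : ∑ m ∈ kPrimeFactors k N.sqrt, thetaError k (N / m) ≤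
        ε / 2 * (N * ∑ m ∈ kPrimeFactors k N, (1 : ℝ) / m) := by
      rw [Finset.mul_sum, Finset.mul_sum]
      refine (Finset.sum_le_sum fun m hm ↦ ?_).trans (Finset.sum_le_sum_of_subset_of_nonneg
        hsub fun m _ _ ↦ by positivity)
      obtain ⟨⟨hm1, hmN⟩, -⟩ := mem_kPrimeFactors.mp hm
      have hle : (N.sqrt : ℝ) ≤ N / m :=
        (Nat.cast_le.mpr (le_div_of_le_sqrt hm1 hmN)).trans Nat.cast_div_le
      obtain ⟨h1, h2⟩ := hX (N / m) (le_trans hs hle)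
      rw [div_lt_iff₀ h2] at h1
      rw [mul_one_div]
      exact h1.le
    have hlarge : ∑ m ∈ kPrimeFactors k N \ kPrimeFactors k N.sqrt, thetaError k (N / m) ≤
        C * (N * (∑ m ∈ kPrimeFactors k N, (1 : ℝ) / m -
          ∑ m ∈ kPrimeFactors k N.sqrt, (1 : ℝ) / m)) := by
      rw [← hsdiff, add_sub_cancel_right, Finset.mul_sum, Finset.mul_sum]
      refine Finset.sum_le_sum fun m hm ↦ ?_
      obtain ⟨⟨hm1, hmN⟩, -⟩ := mem_kPrimeFactors.mp (Finset.mem_sdiff.mp hm).1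
      rw [mul_one_div]
      refine hC _ ?_
      rw [one_le_div (by exact_mod_cast hm1)]
      exact_mod_cast hmN
    simp only [Function.comp_apply] at hLs ⊢
    rw [← Finset.sum_sdiff hsub]
    calc _ ≤ (C * (N * (∑ m ∈ kPrimeFactors k N, (1 : ℝ) / m -
          ∑ m ∈ kPrimeFactors k N.sqrt, (1 : ℝ) / m)) +
          ε / 2 * (N * ∑ m ∈ kPrimeFactors k N, (1 : ℝ) / m)) / (N * log (log N) ^ k) := by
          gcongr
      _ = _ := by
          rw [div_pow]
          field_simp
          ring

lemma tendsto_sum_log_kPrimeFactors (k : ℕ) :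
    Tendsto (fun N : ℕ ↦ (∑ n ∈ kPrimeFactors (k + 1) N, log n) / (N * log (log N) ^ k))
      atTop (𝓝 (1 / k.factorial)) := by
  have h : Tendsto (fun N : ℕ ↦ (∑ n ∈ kPrimeFactors (k + 1) N, log n -
      N * ∑ m ∈ kPrimeFactors k N, (1 : ℝ) / m) / (N * log (log N) ^ k)) atTop (𝓝 0) := by
    refine squeeze_zero_norm' ?_ (tendsto_sum_thetaError k)
    filter_upwards [tendsto_log_log_atTop.eventually_gt_atTop 0] with N hN
    rw [norm_div, norm_of_nonneg (show 0 ≤ N * log (log N) ^ k by positivity), norm_eq_abs]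
    gcongr
    exact abs_sum_log_sub_mul_le k N
  have h2 := h.add (tendsto_sum_one_div_kPrimeFactors k)
  rw [zero_add] at h2
  refine h2.congr' ?_
  filter_upwards [tendsto_log_log_atTop.eventually_gt_atTop 0, eventually_gt_atTop 0] with N hN h0
  have : (0 : ℝ) < N := by exact_mod_cast h0
  field_simp
  ring

lemma sum_log_le (k N : ℕ) :
    ∑ n ∈ kPrimeFactors k N, log n ≤ (kPrimeFactors k N).card * log N := by
  rw [← nsmul_eq_mul]
  refine Finset.sum_le_card_nsmul _ _ _ fun n hn ↦ ?_
  obtain ⟨⟨h1, hN⟩, -⟩ := mem_kPrimeFactors.mp hn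
  exact log_le_log (by exact_mod_cast h1) (by exact_mod_cast hN)

lemma le_sum_log (k : ℕ) {N : ℕ} (hN : 1 ≤ N) {δ : ℝ} (hδ : δ ≤ 1) :
    ((kPrimeFactors k N).card - (N : ℝ) ^ (1 - δ)) * ((1 - δ) * log N) ≤
      ∑ n ∈ kPrimeFactors k N, log n := by
  have hN' : (1 : ℝ) ≤ N := by exact_mod_cast hN
  have hsplit := Finset.card_filter_add_card_filter_not (s := kPrimeFactors k N)
    (fun n ↦ (n : ℝ) ≤ (N : ℝ) ^ (1 - δ))
  have hsmall : (((kPrimeFactors k N).filter fun n : ℕ ↦ (n : ℝ) ≤ (N : ℝ) ^ (1 - δ)).card : ℝ) ≤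
      (N : ℝ) ^ (1 - δ) := by
    have hsub : ((kPrimeFactors k N).filter fun n : ℕ ↦ (n : ℝ) ≤ (N : ℝ) ^ (1 - δ)) ⊆
        Finset.Icc 1 ⌊(N : ℝ) ^ (1 - δ)⌋₊ := fun n hn ↦ by
      rw [Finset.mem_filter, mem_kPrimeFactors] at hn
      exact Finset.mem_Icc.mpr ⟨hn.1.1.1, Nat.le_floor hn.2⟩
    have := Finset.card_le_card hsub
    rw [Nat.card_Icc, Nat.add_sub_cancel] at this
    exact (Nat.cast_le.mpr this).trans (Nat.floor_le (by positivity))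
  have hl : 0 ≤ (1 - δ) * log N := mul_nonneg (by linarith) (log_nonneg hN')
  calc _ ≤ (((kPrimeFactors k N).filter fun n : ℕ ↦ ¬(n : ℝ) ≤ (N : ℝ) ^ (1 - δ)).card : ℝ) *
        ((1 - δ) * log N) := by
        gcongr
        rw [← hsplit]
        push_cast
        linarith
    _ ≤ ∑ n ∈ (kPrimeFactors k N).filter fun n : ℕ ↦ ¬(n : ℝ) ≤ (N : ℝ) ^ (1 - δ), log n := by
        rw [← nsmul_eq_mul]
        refine Finset.card_nsmul_le_sum _ _ _ fun n hn ↦ ?_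
        rw [Finset.mem_filter, not_le] at hn
        rw [← log_rpow (by linarith)]
        exact log_le_log (by positivity) hn.2.le
    _ ≤ _ := Finset.sum_le_sum_of_subset_of_nonneg (Finset.filter_subset _ _)
        fun n _ _ ↦ log_natCast_nonneg n

theorem tendsto_card_kPrimeFactors (k : ℕ) :
    Tendsto (fun N : ℕ ↦ (kPrimeFactors (k + 1) N).card * log N / (N * log (log N) ^ k))
      atTop (𝓝 (1 / k.factorial)) := by
  have hT := tendsto_sum_log_kPrimeFactors k
  have hf : 0 < 1 / (k.factorial : ℝ) := by positivity
  rw [tendsto_order]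
  constructor
  · intro a ha
    filter_upwards [hT.eventually_const_lt ha, tendsto_log_log_atTop.eventually_gt_atTop 0]
      with N hN hL
    refine hN.trans_le ?_
    gcongr
    exact sum_log_le (k + 1) N
  · intro b hb
    obtain ⟨δ, hδ0, hδ1, hδ⟩ : ∃ δ : ℝ, 0 < δ ∧ δ < 1 ∧ 1 / (k.factorial : ℝ) / (1 - δ) < b := by
      have hc : ContinuousAt (fun δ : ℝ ↦ 1 / (k.factorial : ℝ) / (1 - δ)) 0 :=
        ContinuousAt.div (by fun_prop) (by fun_prop) (by norm_num)
      have h1 := hc.eventually_lt_const (u := b) (by simpa using hb)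
      have h2 := (h1.and (eventually_lt_nhds one_pos)).filter_mono
        (nhdsWithin_le_nhds (s := Ioi 0))
      obtain ⟨δ, ⟨h3, h4⟩, h5⟩ := (h2.and self_mem_nhdsWithin).exists
      exact ⟨δ, h5, h4, h3⟩
    have hpow : Tendsto (fun N : ℕ ↦ log N / (N : ℝ) ^ δ) atTop (𝓝 0) :=
      (isLittleO_log_rpow_atTop hδ0).tendsto_div_nhds_zero.comp tendsto_natCast_atTop_atTop
    have hlim := (hT.div_const (1 - δ)).add hpow
    rw [add_zero] at hlim
    filter_upwards [hlim.eventually_lt_const hδ, tendsto_log_log_atTop.eventually_ge_atTop 1,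
      eventually_gt_atTop 0] with N hN hL hN0
    refine lt_of_le_of_lt ?_ hN
    have hN' : (0 : ℝ) < N := by exact_mod_cast hN0
    have h := le_sum_log (k + 1) hN0 hδ1.le
    have hd : 0 < 1 - δ := by linarith
    have hLk : 1 ≤ log (log N) ^ k := one_le_pow₀ hL
    have h2 : (kPrimeFactors (k + 1) N).card * log N ≤
        (∑ n ∈ kPrimeFactors (k + 1) N, log n) / (1 - δ) + (N : ℝ) ^ (1 - δ) * log N := by
      rw [← sub_le_iff_le_add, le_div_iff₀ hd]
      linarith
    rw [rpow_sub hN', rpow_one] at h2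
    calc _ ≤ ((∑ n ∈ kPrimeFactors (k + 1) N, log n) / (1 - δ) + N / (N : ℝ) ^ δ * log N) /
          (N * log (log N) ^ k) := by gcongr
      _ = (∑ n ∈ kPrimeFactors (k + 1) N, log n) / (N * log (log N) ^ k) / (1 - δ) +
          log N / (N : ℝ) ^ δ / log (log N) ^ k := by field_simp
      _ ≤ _ := add_le_add le_rfl (div_le_self (by positivity) hLk)

end LandauPrimeFactors

theorem landau_k_prime_factors (k : ℕ) (hk : 1 ≤ k) :
    Tendsto (fun n : ℕ =>
      (((Finset.Icc 1 n).filter (fun i => i.primeFactors.card = k)).card : ℝ) /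
        ((n : ℝ) * (Real.log (Real.log n)) ^ (k - 1) /
          ((Nat.factorial (k - 1) : ℝ) * Real.log n)))
      atTop (nhds 1) := by
  obtain ⟨k, rfl⟩ := Nat.exists_eq_add_of_le' hk
  have h := (tendsto_card_kPrimeFactors k).const_mul (k.factorial : ℝ)
  rw [mul_one_div_cancel (by positivity)] at h
  refine h.congr fun n ↦ ?_
  rw [Nat.add_sub_cancel, kPrimeFactors, div_div_eq_mul_div]
  ring
end
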